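/- arXiv:1905.03353 — 4 statements merged into one kernel-verified Lean document; each statement's English description precedes it below -/
import Mathlib

section
/- Uniform lower bound on the smallest eigenvalue of the negative Hessian: Under the Ising-type logistic regression model at true parameters (θ₀,β₀) ∈ 𝔹 = [−Θ,Θ]^d × [−B,B], with A symmetric, zero diagonal, ‖A‖_∞ ≤ 1 and ‖A‖_F² ≥ cn (c > 0 constant), x_i ∈ [−M,M]^d, and λ_min((1/n)XᵀX) ≥ q_min > 0, there exists a constant κ > 0 (depending only on d, Θ, B, M, c, q_min) such that for every δ > 0 and all n sufficiently large, with probability at least 1 − δ over y, λ_min(−H_{(θ,β)}) ≥ κ simultaneously for all (θ,β) ∈ 𝔹. -/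
noncomputable section

/-- The ±1 configuration associated to a Boolean configuration. -/
def conf {n : ℕ} (σ : Fin n → Bool) : Fin n → ℝ := fun i => if σ i then 1 else -1

/-- Local magnetization `m_i(y) = Σ_j A_{ij} y_j`. -/
def mag {n : ℕ} (A : Matrix (Fin n) (Fin n) ℝ) (y : Fin n → ℝ) (i : Fin n) : ℝ :=
  ∑ j, A i j * y j

/-- Unnormalized Ising weight `exp(Σ_i (θᵀx_i) σ_i + β σᵀAσ)`. -/
def isingWt {n d : ℕ} (A : Matrix (Fin n) (Fin n) ℝ) (x : Fin n → Fin d → ℝ)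
    (θ : Fin d → ℝ) (β : ℝ) (σ : Fin n → Bool) : ℝ :=
  Real.exp ((∑ i, (∑ k, θ k * x i k) * conf σ i)
    + β * ∑ i, ∑ j, conf σ i * A i j * conf σ j)

/-- Expectation under the Ising-type logistic regression model. -/
def isingE {n d : ℕ} (A : Matrix (Fin n) (Fin n) ℝ) (x : Fin n → Fin d → ℝ)
    (θ : Fin d → ℝ) (β : ℝ) (f : (Fin n → Bool) → ℝ) : ℝ :=
  (∑ σ : Fin n → Bool, isingWt A x θ β σ * f σ) / (∑ σ : Fin n → Bool, isingWt A x θ β σ)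

open Classical in
/-- Probability of an event under the Ising-type logistic regression model. -/
def isingP {n d : ℕ} (A : Matrix (Fin n) (Fin n) ℝ) (x : Fin n → Fin d → ℝ)
    (θ : Fin d → ℝ) (β : ℝ) (P : (Fin n → Bool) → Prop) : ℝ :=
  (∑ σ : Fin n → Bool, if P σ then isingWt A x θ β σ else 0)
    / (∑ σ : Fin n → Bool, isingWt A x θ β σ)

/-- The vector `X_i = (x_iᵀ, m_i(y))ᵀ ∈ ℝ^{d+1}`. -/
def Xvec {n d : ℕ} (A : Matrix (Fin n) (Fin n) ℝ) (x : Fin n → Fin d → ℝ)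
    (y : Fin n → ℝ) (i : Fin n) : (Fin d ⊕ Unit) → ℝ :=
  Sum.elim (x i) (fun _ => mag A y i)

/-- The negative Hessian `−H_{(θ,β)} = (1/n) Σ_i (1/cosh²(β m_i(y)+θᵀx_i)) X_i X_iᵀ`
of the normalized log-pseudolikelihood. -/
def negHess {n d : ℕ} (A : Matrix (Fin n) (Fin n) ℝ) (x : Fin n → Fin d → ℝ)
    (y : Fin n → ℝ) (θ : Fin d → ℝ) (β : ℝ) : Matrix (Fin d ⊕ Unit) (Fin d ⊕ Unit) ℝ :=
  (1/(n:ℝ)) • ∑ i, ((Real.cosh (β * mag A y i + ∑ k, θ k * x i k))^2)⁻¹ •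
    Matrix.vecMulVec (Xvec A x y i) (Xvec A x y i)

/-- The configuration `σ` with its `i`-th coordinate flipped. -/
def flipAt {n : ℕ} (i : Fin n) (σ : Fin n → Bool) : Fin n → Bool :=
  Function.update σ i (!σ i)

/-- The field `θᵀx_i + 2 β m_i` acting on the spin at `i`. -/
def localField {n d : ℕ} (A : Matrix (Fin n) (Fin n) ℝ) (x : Fin n → Fin d → ℝ)
    (θ : Fin d → ℝ) (β : ℝ) (σ : Fin n → Bool) (i : Fin n) : ℝ :=
  ∑ k, θ k * x i k + 2 * β * mag A (conf σ) i

/-- The deviation of the spin at `i` from its conditional mean given the other spins. -/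
def resid {n d : ℕ} (A : Matrix (Fin n) (Fin n) ℝ) (x : Fin n → Fin d → ℝ)
    (θ : Fin d → ℝ) (β : ℝ) (σ : Fin n → Bool) (i : Fin n) : ℝ :=
  conf σ i - Real.tanh (localField A x θ β σ i)

section Flip

variable {n d : ℕ} {A : Matrix (Fin n) (Fin n) ℝ} {x : Fin n → Fin d → ℝ}
  {θ : Fin d → ℝ} {β : ℝ}

theorem flipAt_flipAt (i : Fin n) (σ : Fin n → Bool) : flipAt i (flipAt i σ) = σ := by
  simp [flipAt]

theorem sum_flipAt (i : Fin n) (f : (Fin n → Bool) → ℝ) : ∑ σ, f (flipAt i σ) = ∑ σ, f σ :=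
  Equiv.sum_comp (Function.Involutive.toPerm (flipAt i) (flipAt_flipAt i)) f

theorem conf_mul_self (σ : Fin n → Bool) (i : Fin n) : conf σ i * conf σ i = 1 := by
  unfold conf; split_ifs <;> norm_num

theorem abs_conf (σ : Fin n → Bool) (i : Fin n) : |conf σ i| = 1 := by
  unfold conf; split_ifs <;> norm_num

theorem conf_flipAt (i : Fin n) (σ : Fin n → Bool) (j : Fin n) :
    conf (flipAt i σ) j = conf σ j - 2 * conf σ i * (if j = i then 1 else 0) := by
  by_cases h : j = i
  · subst h
    cases hσ : σ j <;> simp [conf, flipAt, hσ] <;> norm_num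
  · simp [conf, flipAt, h]

theorem sum_mul_conf_flipAt (i : Fin n) (σ : Fin n → Bool) (a : Fin n → ℝ) :
    ∑ j, a j * conf (flipAt i σ) j = ∑ j, a j * conf σ j - 2 * a i * conf σ i := by
  simp only [conf_flipAt, mul_sub, Finset.sum_sub_distrib]
  congr 1
  simp
  ring

theorem mag_flipAt (i : Fin n) (σ : Fin n → Bool) (j : Fin n) :
    mag A (conf (flipAt i σ)) j = mag A (conf σ) j - 2 * A j i * conf σ i :=
  sum_mul_conf_flipAt i σ (A j)

theorem localField_flipAt_self (h0 : ∀ i, A i i = 0) (i : Fin n) (σ : Fin n → Bool) :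
    localField A x θ β (flipAt i σ) i = localField A x θ β σ i := by
  simp [localField, mag_flipAt, h0]

theorem quadForm_flipAt (hA : A.IsSymm) (h0 : ∀ i, A i i = 0) (i : Fin n) (σ : Fin n → Bool) :
    ∑ a, ∑ b, conf (flipAt i σ) a * A a b * conf (flipAt i σ) b
      = ∑ a, ∑ b, conf σ a * A a b * conf σ b - 4 * conf σ i * mag A (conf σ) i := by
  have key : ∀ τ : Fin n → Bool, ∑ a, ∑ b, conf τ a * A a b * conf τ b
      = ∑ a, mag A (conf τ) a * conf τ a := fun τ => by
    refine Finset.sum_congr rfl fun a _ => ?_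
    rw [mag, Finset.sum_mul]
    exact Finset.sum_congr rfl fun b _ => by ring
  rw [key, key, sum_mul_conf_flipAt]
  simp only [mag_flipAt, sub_mul, Finset.sum_sub_distrib]
  have h : ∑ a, 2 * A a i * conf σ i * conf σ a = 2 * conf σ i * mag A (conf σ) i := by
    rw [mag, Finset.mul_sum]
    exact Finset.sum_congr rfl fun a _ => by rw [hA.apply i a]; ring
  rw [h, h0]
  ring

theorem isingWt_flipAt (hA : A.IsSymm) (h0 : ∀ i, A i i = 0) (i : Fin n) (σ : Fin n → Bool) :
    isingWt A x θ β (flipAt i σ)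
      = isingWt A x θ β σ * Real.exp (-(2 * conf σ i * localField A x θ β σ i)) := by
  rw [isingWt, isingWt, ← Real.exp_add, sum_mul_conf_flipAt, quadForm_flipAt hA h0, localField]
  congr 1
  ring

theorem isingWt_mul_resid_flipAt (hA : A.IsSymm) (h0 : ∀ i, A i i = 0) (i : Fin n)
    (σ : Fin n → Bool) :
    isingWt A x θ β (flipAt i σ) * resid A x θ β (flipAt i σ) i
      = -(isingWt A x θ β σ * resid A x θ β σ i) := by
  rw [isingWt_flipAt hA h0, resid, resid, localField_flipAt_self h0, conf_flipAt,
    Real.tanh_eq_sinh_div_cosh, Real.sinh_eq, Real.cosh_eq]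
  generalize localField A x θ β σ i = a
  have h1 : Real.exp a * Real.exp (-a) = 1 := by rw [← Real.exp_add]; simp
  have h2 := Real.exp_pos a
  have h3 := Real.exp_pos (-a)
  rcases (by unfold conf; split_ifs <;> simp : conf σ i = 1 ∨ conf σ i = -1) with h | h
  · rw [h, show -(2 * 1 * a) = -a + -a by ring, Real.exp_add]
    field_simp
    simp
    ring_nf
    linear_combination (-2 * Real.exp (-a)) * isingWt A x θ β σ * h1
  · rw [h, show -(2 * -1 * a) = a + a by ring, Real.exp_add]
    field_simp
    simp
    ring_nf
    linear_combination (2 * Real.exp a) * isingWt A x θ β σ * h1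

theorem isingWt_pos (σ : Fin n → Bool) : 0 < isingWt A x θ β σ := Real.exp_pos _

/-- The residual at `i` is orthogonal to functions that do not depend on the spin at `i`, so its
correlation with `φ` is controlled by the influence of the spin at `i` on `φ`. -/
theorem sum_isingWt_mul_resid_mul_le (hA : A.IsSymm) (h0 : ∀ i, A i i = 0) (i : Fin n)
    (g φ : (Fin n → Bool) → ℝ) {C D : ℝ} (hC : ∀ σ, |resid A x θ β σ i * g σ| ≤ C)
    (hg : ∀ σ, g (flipAt i σ) = g σ) (hφ : ∀ σ, |φ σ - φ (flipAt i σ)| ≤ D) :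
    ∑ σ, isingWt A x θ β σ * ((resid A x θ β σ i * g σ) * φ σ)
      ≤ (C * D / 2) * ∑ σ, isingWt A x θ β σ := by
  have h := sum_flipAt i fun σ => isingWt A x θ β σ * ((resid A x θ β σ i * g σ) * φ σ)
  have h' : ∑ σ, isingWt A x θ β σ * ((resid A x θ β σ i * g σ) * φ σ)
      = ∑ σ, isingWt A x θ β σ * ((resid A x θ β σ i * g σ) * (φ σ - φ (flipAt i σ))) / 2 := by
    have e : ∀ σ, isingWt A x θ β (flipAt i σ) *
        ((resid A x θ β (flipAt i σ) i * g (flipAt i σ)) * φ (flipAt i σ))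
        = -(isingWt A x θ β σ * ((resid A x θ β σ i * g σ) * φ (flipAt i σ))) := fun σ => by
      rw [hg]
      linear_combination (g σ * φ (flipAt i σ)) * isingWt_mul_resid_flipAt hA h0 i σ
    simp only [e, Finset.sum_neg_distrib] at h
    rw [← Finset.sum_div]
    simp only [mul_sub, Finset.sum_sub_distrib]
    linarith
  rw [h', Finset.mul_sum]
  refine Finset.sum_le_sum fun σ _ => ?_
  have hb : (resid A x θ β σ i * g σ) * (φ σ - φ (flipAt i σ)) ≤ C * D :=
    (le_abs_self _).trans <| by
      rw [abs_mul]
      exact mul_le_mul (hC σ) (hφ σ) (abs_nonneg _) ((abs_nonneg _).trans (hC σ))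
  nlinarith [isingWt_pos (A := A) (x := x) (θ := θ) (β := β) σ]

theorem abs_tanh_sub_tanh_le (a b : ℝ) : |Real.tanh a - Real.tanh b| ≤ |a - b| := by
  have hd : ∀ y ∈ (Set.univ : Set ℝ),
      HasDerivWithinAt Real.tanh (1 / Real.cosh y ^ 2) Set.univ y := fun y _ => by
    have h := (Real.hasDerivAt_sinh y).div (Real.hasDerivAt_cosh y) (Real.cosh_pos y).ne'
    have e : Real.tanh = Real.sinh / Real.cosh := funext Real.tanh_eq_sinh_div_cosh
    rw [e]
    refine HasDerivAt.hasDerivWithinAt (h.congr_deriv ?_)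
    rw [← Real.cosh_sq_sub_sinh_sq y]
    ring
  have hb : ∀ y ∈ (Set.univ : Set ℝ), ‖1 / Real.cosh y ^ 2‖ ≤ 1 := fun y _ => by
    have := Real.one_le_cosh y
    rw [Real.norm_of_nonneg (by positivity), div_le_one (by positivity)]
    nlinarith
  simpa using convex_univ.norm_image_sub_le_of_norm_hasDerivWithin_le hd hb
    (Set.mem_univ b) (Set.mem_univ a)

theorem abs_resid_le (σ : Fin n → Bool) (i : Fin n) : |resid A x θ β σ i| ≤ 2 := by
  have h1 := (Real.abs_tanh_lt_one (localField A x θ β σ i)).le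
  have h2 := abs_conf σ i
  rw [resid]
  linarith [abs_sub (conf σ i) (Real.tanh (localField A x θ β σ i))]

theorem abs_resid_sub_resid_flipAt_le {B : ℝ} (hβ : |β| ≤ B) (i j : Fin n) (σ : Fin n → Bool) :
    |resid A x θ β σ j - resid A x θ β (flipAt i σ) j|
      ≤ 2 * (if j = i then 1 else 0) + 4 * B * |A j i| := by
  have h1 := abs_tanh_sub_tanh_le (localField A x θ β (flipAt i σ) j) (localField A x θ β σ j)
  have h2 : |localField A x θ β (flipAt i σ) j - localField A x θ β σ j| ≤ 4 * B * |A j i| := by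
    have e : localField A x θ β (flipAt i σ) j - localField A x θ β σ j
        = -(4 * β * A j i * conf σ i) := by
      rw [localField, localField, mag_flipAt]; ring
    rw [e, abs_neg, abs_mul, abs_conf, abs_mul, abs_mul, mul_one, abs_of_pos four_pos]
    gcongr
  have e : resid A x θ β σ j - resid A x θ β (flipAt i σ) j
      = 2 * conf σ i * (if j = i then 1 else 0)
        + (Real.tanh (localField A x θ β (flipAt i σ) j) - Real.tanh (localField A x θ β σ j)) := by
    rw [resid, resid, conf_flipAt]; ring
  have h3 : |2 * conf σ i * (if j = i then 1 else 0)| = 2 * (if j = i then (1 : ℝ) else 0) := by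
    rw [abs_mul, abs_mul, abs_conf]; split_ifs <;> simp
  rw [e]
  exact (abs_add_le _ _).trans (by rw [h3]; linarith)

/-- Second moment bound for sums of residuals, weighted by functions `g i` that do not depend on
the spin at `i` and depend weakly on the other spins. -/
theorem sum_isingWt_mul_sq_le (hA : A.IsSymm) (h0 : ∀ i, A i i = 0)
    (hrow : ∀ j, ∑ i, |A i j| ≤ 1) {B K ℓ : ℝ} (hβ : |β| ≤ B) (hK : 0 ≤ K)
    (g : Fin n → (Fin n → Bool) → ℝ) (L : Fin n → Fin n → ℝ)
    (hgK : ∀ i σ, |g i σ| ≤ K) (hg : ∀ i σ, g i (flipAt i σ) = g i σ)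
    (hgL : ∀ i j σ, |g j σ - g j (flipAt i σ)| ≤ L i j) (hL : ∑ i, ∑ j, L i j ≤ ℓ * n) :
    ∑ σ, isingWt A x θ β σ * (∑ i, resid A x θ β σ i * g i σ) ^ 2
      ≤ (2 * K ^ 2 + 4 * B * K ^ 2 + 2 * K * ℓ) * n * ∑ σ, isingWt A x θ β σ := by
  have hB : 0 ≤ B := (abs_nonneg _).trans hβ
  have hW : 0 ≤ ∑ σ, isingWt A x θ β σ := Finset.sum_nonneg fun σ _ => (isingWt_pos σ).le
  set D : Fin n → Fin n → ℝ := fun i j =>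
    (2 * (if j = i then 1 else 0) + 4 * B * |A j i|) * K + 2 * L i j
  have hφ : ∀ i j σ, |resid A x θ β σ j * g j σ
      - resid A x θ β (flipAt i σ) j * g j (flipAt i σ)| ≤ D i j := fun i j σ => by
    have e : resid A x θ β σ j * g j σ - resid A x θ β (flipAt i σ) j * g j (flipAt i σ)
        = (resid A x θ β σ j - resid A x θ β (flipAt i σ) j) * g j σ
          + resid A x θ β (flipAt i σ) j * (g j σ - g j (flipAt i σ)) := by ring
    rw [e]
    refine (abs_add_le _ _).trans ?_
    rw [abs_mul, abs_mul]
    have h1 := abs_resid_sub_resid_flipAt_le (A := A) (x := x) (θ := θ) hβ i j σ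
    exact add_le_add (mul_le_mul h1 (hgK j σ) (abs_nonneg _) ((abs_nonneg _).trans h1))
      (mul_le_mul (abs_resid_le _ j) (hgL i j σ) (abs_nonneg _) zero_le_two)
  have hC : ∀ i σ, |resid A x θ β σ i * g i σ| ≤ 2 * K := fun i σ => by
    rw [abs_mul]
    exact mul_le_mul (abs_resid_le _ i) (hgK i σ) (abs_nonneg _) zero_le_two
  have hexp : ∑ σ, isingWt A x θ β σ * (∑ i, resid A x θ β σ i * g i σ) ^ 2
      = ∑ i, ∑ j, ∑ σ, isingWt A x θ β σ *
        ((resid A x θ β σ i * g i σ) * (resid A x θ β σ j * g j σ)) := by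
    simp only [sq, Finset.sum_mul_sum]
    simp only [Finset.mul_sum]
    rw [Finset.sum_comm]
    exact Finset.sum_congr rfl fun i _ => Finset.sum_comm
  have hD : ∑ i, ∑ j, D i j ≤ (2 * K + 4 * B * K + 2 * ℓ) * n := by
    have h1 : ∑ i, ∑ j, |A j i| ≤ (n : ℝ) :=
      (Finset.sum_le_sum fun i _ => hrow i).trans (by simp)
    have h2 : ∑ i, ∑ j, D i j
        = 2 * K * n + 4 * B * K * ∑ i, ∑ j, |A j i| + 2 * ∑ i, ∑ j, L i j := by
      simp only [D, Finset.sum_add_distrib, add_mul, ← Finset.sum_mul, ← Finset.mul_sum]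
      simp
      ring
    have h3 : 4 * B * K * ∑ i, ∑ j, |A j i| ≤ 4 * B * K * n :=
      mul_le_mul_of_nonneg_left h1 (by positivity)
    rw [h2]
    linarith
  rw [hexp]
  calc _ ≤ ∑ i, ∑ j, (2 * K * D i j / 2) * ∑ σ, isingWt A x θ β σ :=
        Finset.sum_le_sum fun i _ => Finset.sum_le_sum fun j _ =>
          sum_isingWt_mul_resid_mul_le hA h0 i (g i) (fun σ => resid A x θ β σ j * g j σ)
            (hC i) (hg i) (hφ i j)
    _ = K * (∑ i, ∑ j, D i j) * ∑ σ, isingWt A x θ β σ := by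
        have e : ∀ i j, 2 * K * D i j / 2 = K * D i j := fun i j => by ring
        simp only [e, ← Finset.sum_mul, ← Finset.mul_sum]
    _ ≤ K * ((2 * K + 4 * B * K + 2 * ℓ) * n) * ∑ σ, isingWt A x θ β σ := by gcongr
    _ = _ := by ring

theorem sum_mul_mag (z r : Fin n → ℝ) :
    ∑ i, z i * mag A r i = ∑ j, r j * ∑ i, A i j * z i := by
  simp only [mag, Finset.mul_sum]
  rw [Finset.sum_comm]
  exact Finset.sum_congr rfl fun j _ => Finset.sum_congr rfl fun i _ => by ring

theorem abs_mag_le (hA : A.IsSymm) (hrow : ∀ j, ∑ i, |A i j| ≤ 1) {y : Fin n → ℝ} {K : ℝ}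
    (hK : 0 ≤ K) (hy : ∀ i, |y i| ≤ K) (i : Fin n) : |mag A y i| ≤ K := by
  calc |mag A y i| ≤ ∑ j, |A i j * y j| := Finset.abs_sum_le_sum_abs _ _
    _ ≤ ∑ j, |A j i| * K := Finset.sum_le_sum fun j _ => by
        rw [abs_mul, hA.apply j i]
        exact mul_le_mul_of_nonneg_left (hy j) (abs_nonneg _)
    _ = (∑ j, |A j i|) * K := by rw [Finset.sum_mul]
    _ ≤ 1 * K := mul_le_mul_of_nonneg_right (hrow i) hK
    _ = K := one_mul K

/-- The part of `(AᵀA y)_j` that does not involve the spin at `j`. -/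
def offDiag (A : Matrix (Fin n) (Fin n) ℝ) (j : Fin n) (σ : Fin n → Bool) : ℝ :=
  ∑ k, (if k = j then 0 else ∑ i, A i j * A i k) * conf σ k

theorem sum_abs_gram_le (hA : A.IsSymm) (hrow : ∀ j, ∑ i, |A i j| ≤ 1) (j : Fin n) :
    ∑ k, |∑ i, A i j * A i k| ≤ 1 := by
  calc ∑ k, |∑ i, A i j * A i k| ≤ ∑ k, ∑ i, |A i j| * |A k i| :=
        Finset.sum_le_sum fun k _ => (Finset.abs_sum_le_sum_abs _ _).trans_eq <|
          Finset.sum_congr rfl fun i _ => by rw [abs_mul, hA.apply k i]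
    _ = ∑ i, |A i j| * ∑ k, |A k i| := by
        rw [Finset.sum_comm]; exact Finset.sum_congr rfl fun i _ => (Finset.mul_sum _ _ _).symm
    _ ≤ ∑ i, |A i j| := Finset.sum_le_sum fun i _ =>
        mul_le_of_le_one_right (abs_nonneg _) (hrow i)
    _ ≤ 1 := hrow j

theorem sum_isingWt_mul_offDiag_sq_le (hA : A.IsSymm) (h0 : ∀ i, A i i = 0)
    (hrow : ∀ j, ∑ i, |A i j| ≤ 1) {B : ℝ} (hβ : |β| ≤ B) :
    ∑ σ, isingWt A x θ β σ * (∑ i, resid A x θ β σ i * offDiag A i σ) ^ 2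
      ≤ (6 + 4 * B) * n * ∑ σ, isingWt A x θ β σ := by
  have hle : ∀ j k, |if k = j then 0 else ∑ i, A i j * A i k| ≤ |∑ i, A i j * A i k| :=
    fun j k => by split_ifs <;> simp
  have h := sum_isingWt_mul_sq_le (x := x) (θ := θ) (K := 1) (ℓ := 2) hA h0 hrow hβ zero_le_one
    (offDiag A) (fun i j => 2 * |∑ l, A l j * A l i|) (fun j σ => ?_) (fun i σ => ?_)
    (fun i j σ => ?_) ?_
  · exact h.trans_eq (by ring)
  · refine (Finset.abs_sum_le_sum_abs _ _).trans (le_trans ?_ (sum_abs_gram_le hA hrow j))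
    exact Finset.sum_le_sum fun k _ => by
      rw [abs_mul, abs_conf, mul_one]; exact hle j k
  · rw [offDiag, sum_mul_conf_flipAt]
    simp [offDiag]
  · rw [offDiag, offDiag, sum_mul_conf_flipAt, sub_sub_cancel, abs_mul, abs_mul, abs_conf,
      mul_one, abs_of_pos two_pos]
    exact mul_le_mul_of_nonneg_left (hle j i) zero_le_two
  · rw [Finset.sum_comm]
    simp only [← Finset.mul_sum]
    have : ∑ j, ∑ i, |∑ l, A l j * A l i| ≤ (n : ℝ) :=
      (Finset.sum_le_sum fun j _ => sum_abs_gram_le hA hrow j).trans (by simp)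
    linarith

theorem sum_isingWt_mul_feature_sq_le (hA : A.IsSymm) (h0 : ∀ i, A i i = 0)
    (hrow : ∀ j, ∑ i, |A i j| ≤ 1) {B M : ℝ} (hβ : |β| ≤ B) (hM : 0 ≤ M)
    {z : Fin n → ℝ} (hz : ∀ i, |z i| ≤ M) :
    ∑ σ, isingWt A x θ β σ * (∑ i, z i * mag A (resid A x θ β σ) i) ^ 2
      ≤ (2 + 4 * B) * M ^ 2 * n * ∑ σ, isingWt A x θ β σ := by
  simp only [sum_mul_mag]
  have h := sum_isingWt_mul_sq_le (x := x) (θ := θ) (K := M) (ℓ := 0) hA h0 hrow hβ hM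
    (fun j _ => ∑ i, A i j * z i) (fun _ _ => 0) (fun j _ => ?_) (fun _ _ => rfl) (by simp)
    (by simp)
  · exact h.trans_eq (by ring)
  · have := abs_mag_le hA hrow hM hz j
    simpa only [mag, hA.apply] using this

theorem resid_mul_conf_ge {a : ℝ} (σ : Fin n → Bool) (i : Fin n)
    (ha : |localField A x θ β σ i| ≤ a) :
    1 / (2 * Real.cosh a ^ 2) ≤ resid A x θ β σ i * conf σ i := by
  have hc : Real.cosh (localField A x θ β σ i) ≤ Real.cosh a :=
    Real.cosh_le_cosh.2 (ha.trans (le_abs_self a))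
  rw [resid, sub_mul, conf_mul_self]
  generalize localField A x θ β σ i = b at *
  have h1 := Real.cosh_pos b
  have h2 : Real.tanh b ^ 2 = 1 - 1 / Real.cosh b ^ 2 := by
    rw [Real.tanh_eq_sinh_div_cosh, div_pow, Real.sinh_sq]
    field_simp
  have h3 : 1 / Real.cosh a ^ 2 ≤ 1 / Real.cosh b ^ 2 := by gcongr
  have h4 : (Real.tanh b * conf σ i) ^ 2 = Real.tanh b ^ 2 := by
    rw [mul_pow, sq (conf σ i), conf_mul_self, mul_one]
  have h5 : 1 / (2 * Real.cosh a ^ 2) = 1 / Real.cosh a ^ 2 / 2 := by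
    field_simp
  rw [h5]
  nlinarith [sq_nonneg (1 - Real.tanh b * conf σ i)]

theorem abs_linear_le {D M Θ : ℝ} (hD : (d : ℝ) * Θ * M ≤ D) (hΘ : 0 ≤ Θ)
    (hx : ∀ i k, |x i k| ≤ M) (hθ : ∀ k, |θ k| ≤ Θ) (i : Fin n) :
    |∑ k, θ k * x i k| ≤ D := by
  refine (Finset.abs_sum_le_sum_abs _ _).trans (le_trans ?_ hD)
  calc ∑ k, |θ k * x i k| ≤ ∑ _k : Fin d, Θ * M := Finset.sum_le_sum fun k _ => by
        rw [abs_mul]; exact mul_le_mul (hθ k) (hx i k) (abs_nonneg _) hΘ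
    _ = d * Θ * M := by simp; ring

theorem sum_mag_conf_mul_mag_resid (σ : Fin n → Bool) :
    ∑ i, mag A (conf σ) i * mag A (resid A x θ β σ) i
      = ∑ j, resid A x θ β σ j * offDiag A j σ
        + ∑ j, (∑ i, A i j ^ 2) * (resid A x θ β σ j * conf σ j) := by
  rw [sum_mul_mag, ← Finset.sum_add_distrib]
  refine Finset.sum_congr rfl fun j _ => ?_
  have e : ∑ i, A i j * mag A (conf σ) i = offDiag A j σ + (∑ i, A i j ^ 2) * conf σ j := by
    have h1 : ∑ i, A i j * mag A (conf σ) i = ∑ k, (∑ i, A i j * A i k) * conf σ k := by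
      simp only [mag, Finset.mul_sum, Finset.sum_mul]
      rw [Finset.sum_comm]
      exact Finset.sum_congr rfl fun k _ => Finset.sum_congr rfl fun i _ => by ring
    rw [h1, offDiag, ← Finset.sum_erase_add _ _ (Finset.mem_univ j),
      ← Finset.sum_erase_add (a := j) Finset.univ (fun k => (if k = j then 0 else _) * _)
        (Finset.mem_univ j)]
    simp only [if_true, zero_mul, add_zero, sq]
    congr 1
    exact Finset.sum_congr rfl fun k hk => by rw [if_neg (Finset.ne_of_mem_erase hk)]
  rw [e]
  ring

theorem sum_sum_mul_vecMulVec {ι : Type*} [Fintype ι] (v X : ι → ℝ) :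
    ∑ a, ∑ b, v a * Matrix.vecMulVec X X a b * v b = (∑ a, v a * X a) ^ 2 := by
  rw [sq, Finset.sum_mul_sum]
  exact Finset.sum_congr rfl fun a _ => Finset.sum_congr rfl fun b _ => by
    rw [Matrix.vecMulVec_apply]; ring

theorem quadForm_negHess (y : Fin n → ℝ) (v : Fin d ⊕ Unit → ℝ) :
    ∑ a, ∑ b, v a * negHess A x y θ β a b * v b
      = 1 / n * ∑ i, (Real.cosh (β * mag A y i + ∑ k, θ k * x i k) ^ 2)⁻¹
        * (∑ k, v (.inl k) * x i k + v (.inr ()) * mag A y i) ^ 2 := by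
  have e : ∀ i, ∑ k, v (.inl k) * x i k + v (.inr ()) * mag A y i
      = ∑ a, v a * Xvec A x y i a := fun i => by
    simp [Fintype.sum_sum_type, Xvec]
  simp only [e, ← sum_sum_mul_vecMulVec, negHess, Matrix.smul_apply, Matrix.sum_apply,
    smul_eq_mul, Finset.mul_sum, Finset.sum_mul]
  rw [Finset.sum_comm' (t' := Finset.univ) (s' := fun _ => Finset.univ) (by simp)]
  conv_rhs => rw [Finset.sum_comm]
  rw [Finset.sum_comm]
  refine Finset.sum_congr rfl fun a _ => ?_
  conv_rhs => rw [Finset.sum_comm]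
  exact Finset.sum_congr rfl fun b _ => Finset.sum_congr rfl fun i _ => by ring

theorem quadForm_gram (u : Fin d → ℝ) :
    ∑ k, ∑ l, u k * ((1 / (n : ℝ)) * ∑ i, x i k * x i l) * u l
      = 1 / n * ∑ i, (∑ k, u k * x i k) ^ 2 := by
  simp only [← sum_sum_mul_vecMulVec, Matrix.vecMulVec_apply, Finset.mul_sum, Finset.sum_mul]
  conv_rhs => rw [Finset.sum_comm]
  refine Finset.sum_congr rfl fun a _ => ?_
  conv_rhs => rw [Finset.sum_comm]
  exact Finset.sum_congr rfl fun b _ => Finset.sum_congr rfl fun i _ => by ring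

/-- If the vector `b` is bounded, correlates with `m` and is almost orthogonal to the features,
then `m` stays away from the span of the features. -/
theorem add_sq_le_of_correlated {m b : Fin n → ℝ} {q c ε : ℝ} (hn : 0 < n)
    (hq : 0 < q) (hc : 0 < c) (hεq : 8 * ε ≤ q * c ^ 2)
    (hm : ∀ i, |m i| ≤ 1) (hb : ∀ i, |b i| ≤ 2)
    (hgram : ∀ u : Fin d → ℝ, q * ∑ k, u k ^ 2 ≤ 1 / n * ∑ i, (∑ k, u k * x i k) ^ 2)
    (hmb : c * n ≤ ∑ i, m i * b i) (hxb : ∑ k, (∑ i, x i k * b i) ^ 2 ≤ ε * n ^ 2)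
    (u : Fin d → ℝ) (s : ℝ) :
    ∑ k, u k ^ 2 + s ^ 2
      ≤ (2 / q + (2 / q + 1) * (16 / c ^ 2 + 1))
        * (1 / n * ∑ i, (∑ k, u k * x i k + s * m i) ^ 2) := by
  have hn' : (0 : ℝ) < n := Nat.cast_pos.2 hn
  set z : Fin n → ℝ := fun i => ∑ k, u k * x i k + s * m i with hz
  set Z := 1 / (n : ℝ) * ∑ i, z i ^ 2 with hZ
  set U := ∑ k, u k ^ 2
  have hU : 0 ≤ U := Finset.sum_nonneg fun k _ => sq_nonneg _
  have hZ0 : 0 ≤ Z := by positivity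
  have hZn : ∑ i, z i ^ 2 = n * Z := by rw [hZ]; field_simp
  have h1 : q * U ≤ 2 * Z + 2 * s ^ 2 := by
    refine (hgram u).trans ?_
    have : ∑ i, (∑ k, u k * x i k) ^ 2 ≤ 2 * ∑ i, z i ^ 2 + 2 * s ^ 2 * n := by
      calc ∑ i, (∑ k, u k * x i k) ^ 2 ≤ ∑ i, (2 * z i ^ 2 + 2 * s ^ 2) :=
            Finset.sum_le_sum fun i _ => by
              have h2 : m i ^ 2 ≤ 1 := (sq_le_one_iff_abs_le_one _).2 (hm i)
              have h3 : ∑ k, u k * x i k = z i - s * m i := by simp [hz]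
              rw [h3]
              nlinarith [sq_nonneg (z i + s * m i), mul_le_mul_of_nonneg_left h2 (sq_nonneg s)]
        _ = _ := by
          rw [Finset.sum_add_distrib, ← Finset.mul_sum]; simp; ring
    rw [hZn] at this
    calc _ ≤ 1 / (n : ℝ) * (2 * (n * Z) + 2 * s ^ 2 * n) := by gcongr
      _ = _ := by field_simp
  have h2 : ∑ i, z i * b i
      = s * ∑ i, m i * b i + ∑ k, u k * ∑ i, x i k * b i := by
    simp only [hz, add_mul, Finset.sum_add_distrib, Finset.mul_sum, Finset.sum_mul]
    rw [add_comm, Finset.sum_comm]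
    congr 1
    · exact Finset.sum_congr rfl fun i _ => by ring
    · exact Finset.sum_congr rfl fun k _ => Finset.sum_congr rfl fun i _ => by ring
  have h3 : (∑ i, z i * b i) ^ 2 ≤ 4 * n ^ 2 * Z := by
    refine (Finset.sum_mul_sq_le_sq_mul_sq _ _ _).trans ?_
    have : ∑ i, b i ^ 2 ≤ 4 * n := by
      calc ∑ i, b i ^ 2 ≤ ∑ _i : Fin n, (4 : ℝ) := Finset.sum_le_sum fun i _ => by
            have := sq_le_sq' (abs_le.1 (hb i)).1 (abs_le.1 (hb i)).2
            linarith
        _ = _ := by simp; ring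
    rw [hZn]
    calc n * Z * ∑ i, b i ^ 2 ≤ n * Z * (4 * n) := by gcongr
      _ = _ := by ring
  have h4 : (∑ k, u k * ∑ i, x i k * b i) ^ 2 ≤ U * (ε * n ^ 2) :=
    (Finset.sum_mul_sq_le_sq_mul_sq _ _ _).trans (mul_le_mul_of_nonneg_left hxb hU)
  have h5 : (s * (c * n)) ^ 2 ≤ 8 * n ^ 2 * Z + 2 * (U * (ε * n ^ 2)) := by
    have h6 : (s * (c * n)) ^ 2 ≤ (s * ∑ i, m i * b i) ^ 2 := by
      rw [mul_pow, mul_pow s]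
      gcongr
    have h7 : s * ∑ i, m i * b i = ∑ i, z i * b i - ∑ k, u k * ∑ i, x i k * b i := by
      rw [h2]; ring
    rw [h7] at h6
    nlinarith [sq_nonneg (∑ i, z i * b i + ∑ k, u k * ∑ i, x i k * b i)]
  have h6 : s ^ 2 * c ^ 2 ≤ 8 * Z + 2 * U * ε := by
    have : (s ^ 2 * c ^ 2) * (n : ℝ) ^ 2 ≤ (8 * Z + 2 * U * ε) * n ^ 2 := by nlinarith
    exact le_of_mul_le_mul_right this (by positivity)
  have h7 : 4 * (2 * U * ε) ≤ c ^ 2 * (2 * Z + 2 * s ^ 2) := by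
    calc 4 * (2 * U * ε) = U * (8 * ε) := by ring
      _ ≤ U * (q * c ^ 2) := by gcongr
      _ = c ^ 2 * (q * U) := by ring
      _ ≤ _ := by gcongr
  have h8 : s ^ 2 ≤ (16 / c ^ 2 + 1) * Z := by
    have : c ^ 2 * s ^ 2 ≤ c ^ 2 * ((16 / c ^ 2 + 1) * Z) := by
      have e : c ^ 2 * ((16 / c ^ 2 + 1) * Z) = 16 * Z + c ^ 2 * Z := by field_simp
      rw [e]
      linarith
    exact le_of_mul_le_mul_left this (by positivity)
  have h9 : U ≤ 2 / q * Z + 2 / q * s ^ 2 := by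
    have e : 2 / q * Z + 2 / q * s ^ 2 = (2 * Z + 2 * s ^ 2) / q := by ring
    rw [e, le_div_iff₀ hq]
    linarith
  have h10 : (2 / q + 1) * s ^ 2 ≤ (2 / q + 1) * ((16 / c ^ 2 + 1) * Z) := by gcongr
  linarith

/-- Markov's inequality: an event holds with high probability if a nonnegative function with small
mean is at least `1` off the event. -/
theorem one_sub_le_isingP {P : (Fin n → Bool) → Prop} {δ : ℝ} (f : (Fin n → Bool) → ℝ)
    (hf : ∀ σ, 0 ≤ f σ) (hP : ∀ σ, f σ < 1 → P σ)
    (hE : ∑ σ, isingWt A x θ β σ * f σ ≤ δ * ∑ σ, isingWt A x θ β σ) :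
    1 - δ ≤ isingP A x θ β P := by
  classical
  have hW : 0 < ∑ σ, isingWt A x θ β σ :=
    Finset.sum_pos (fun σ _ => isingWt_pos σ) Finset.univ_nonempty
  rw [isingP, le_div_iff₀ hW]
  have h : ∑ σ, isingWt A x θ β σ ≤ ∑ σ, ((if P σ then isingWt A x θ β σ else 0)
      + isingWt A x θ β σ * f σ) := Finset.sum_le_sum fun σ _ => by
    have hw := isingWt_pos (A := A) (x := x) (θ := θ) (β := β) σ
    by_cases hσ : P σ
    · rw [if_pos hσ]
      linarith [mul_nonneg hw.le (hf σ)]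
    · rw [if_neg hσ]
      have h1 : 1 ≤ f σ := not_lt.1 fun hlt => hσ (hP σ hlt)
      nlinarith
  rw [Finset.sum_add_distrib] at h
  calc _ ≤ ∑ σ, (if P σ then isingWt A x θ β σ else 0) := by linarith
    _ ≤ _ := le_of_eq (Finset.sum_congr rfl fun σ _ => by congr)

theorem mul_add_sq_le_quadForm_negHess {a K : ℝ} {y : Fin n → ℝ} (hK : 0 < K)
    (hy : ∀ i, |β * mag A y i + ∑ k, θ k * x i k| ≤ a) (v : Fin d ⊕ Unit → ℝ)
    (h : ∑ k, v (.inl k) ^ 2 + v (.inr ()) ^ 2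
      ≤ K * (1 / n * ∑ i, (∑ k, v (.inl k) * x i k + v (.inr ()) * mag A y i) ^ 2)) :
    (Real.cosh a ^ 2)⁻¹ / K * ∑ j, v j ^ 2
      ≤ ∑ j, ∑ l, v j * negHess A x y θ β j l * v l := by
  have e : ∑ j, v j ^ 2 = ∑ k, v (.inl k) ^ 2 + v (.inr ()) ^ 2 := by
    simp [Fintype.sum_sum_type]
  rw [quadForm_negHess, e]
  have hca := Real.cosh_pos a
  calc _ ≤ (Real.cosh a ^ 2)⁻¹ / K * (K * (1 / n
          * ∑ i, (∑ k, v (.inl k) * x i k + v (.inr ()) * mag A y i) ^ 2)) := by gcongr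
    _ = 1 / n * ∑ i, (Real.cosh a ^ 2)⁻¹
          * (∑ k, v (.inl k) * x i k + v (.inr ()) * mag A y i) ^ 2 := by
        rw [← Finset.mul_sum]; field_simp
    _ ≤ _ := by
        gcongr with i
        exact Real.cosh_le_cosh.2 ((hy i).trans (le_abs_self a))

end Flip

/-- **Uniform lower bound on the smallest eigenvalue of the negative
Hessian.** Under the Ising-type logistic regression model with the stated assumptions,
there is a constant `κ > 0` (depending only on `d, Θ, B, M, c, q_min`) such that for every
`δ > 0` and all `n` sufficiently large, with probability at least `1 − δ` over `y`,
`λ_min(−H_{(θ,β)}) ≥ κ` simultaneously for all `(θ,β) ∈ 𝔹 = [−Θ,Θ]^d × [−B,B]`. -/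
theorem statement7 (d : ℕ) (Θ B M c qmin : ℝ)
    (hΘ : 0 < Θ) (hB : 0 < B) (hM : 0 < M) (hc : 0 < c) (hqmin : 0 < qmin) :
    ∃ κ : ℝ, 0 < κ ∧ ∀ δ : ℝ, 0 < δ → ∃ n₀ : ℕ, ∀ n : ℕ, n₀ ≤ n →
      ∀ (A : Matrix (Fin n) (Fin n) ℝ) (x : Fin n → Fin d → ℝ)
        (θ₀ : Fin d → ℝ) (β₀ : ℝ),
        A.IsSymm → (∀ i, A i i = 0) →
        (∀ j, ∑ i, |A i j| ≤ 1) →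
        (c * n ≤ ∑ i, ∑ j, (A i j)^2) →
        (∀ i k, |x i k| ≤ M) →
        (∀ v : Fin d → ℝ, qmin * ∑ k, (v k)^2
          ≤ ∑ k, ∑ l, v k * ((1/(n:ℝ)) * ∑ i, x i k * x i l) * v l) →
        (∀ k, |θ₀ k| ≤ Θ) → |β₀| ≤ B →
        1 - δ ≤ isingP A x θ₀ β₀ (fun σ =>
          ∀ (θ : Fin d → ℝ) (β : ℝ), (∀ k, |θ k| ≤ Θ) → |β| ≤ B →
            ∀ v : (Fin d ⊕ Unit) → ℝ,
              κ * ∑ a, (v a)^2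
                ≤ ∑ a, ∑ b, v a * negHess A x (conf σ) θ β a b * v b) := by
  set a : ℝ := 2 * B + d * Θ * M
  set c₁ : ℝ := c / (4 * Real.cosh a ^ 2) with hc₁
  have hcosh := Real.cosh_pos a
  have hc₁0 : 0 < c₁ := by positivity
  set ε : ℝ := min (c₁ ^ 2) (qmin * c₁ ^ 2 / 8)
  have hε0 : 0 < ε := lt_min (by positivity) (by positivity)
  set K : ℝ := 2 / qmin + (2 / qmin + 1) * (16 / c₁ ^ 2 + 1)
  have hK0 : 0 < K := by positivity
  refine ⟨(Real.cosh a ^ 2)⁻¹ / K, by positivity, fun δ hδ => ?_⟩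
  set C : ℝ := 6 + 4 * B + d * ((2 + 4 * B) * M ^ 2) with hC
  have hC0 : 0 < C := by positivity
  obtain ⟨N, hN⟩ := exists_nat_gt (C / (ε * δ))
  refine ⟨N + 1, fun n hn A x θ₀ β₀ hA h0 hrow hF hx hgram hθ₀ hβ₀ => ?_⟩
  have hn0 : 0 < n := by omega
  have hn' : (0 : ℝ) < n := Nat.cast_pos.2 hn0
  have hCn : C * n ≤ δ * (ε * n ^ 2) := by
    have h1 : C / (ε * δ) ≤ n := hN.le.trans (by exact_mod_cast (by omega : N ≤ n))
    rw [div_le_iff₀ (by positivity)] at h1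
    nlinarith
  have hlin : ∀ (θ : Fin d → ℝ), (∀ k, |θ k| ≤ Θ) → ∀ i, |∑ k, θ k * x i k| ≤ d * Θ * M :=
    fun θ hθ i => abs_linear_le le_rfl hΘ.le hx hθ i
  have hmag : ∀ σ i, |mag A (conf σ) i| ≤ 1 := fun σ i =>
    abs_mag_le hA hrow zero_le_one (fun j => (abs_conf σ j).le) i
  have hβm : ∀ β, |β| ≤ B → ∀ σ i, |β * mag A (conf σ) i| ≤ B := fun β hβ σ i => by
    rw [abs_mul]
    exact (mul_le_mul hβ (hmag σ i) (abs_nonneg _) hB.le).trans_eq (mul_one B)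
  set S : (Fin n → Bool) → ℝ := fun σ => ∑ i, resid A x θ₀ β₀ σ i * offDiag A i σ
  set R : Fin d → (Fin n → Bool) → ℝ :=
    fun k σ => ∑ i, x i k * mag A (resid A x θ₀ β₀ σ) i
  refine one_sub_le_isingP (fun σ => (S σ ^ 2 + ∑ k, R k σ ^ 2) / (ε * n ^ 2))
    (fun σ => by positivity) (fun σ hσ θ β hθ hβ v => ?_) ?_
  · rw [div_lt_one (by positivity)] at hσ
    have hR0 : 0 ≤ ∑ k, R k σ ^ 2 := Finset.sum_nonneg fun k _ => sq_nonneg _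
    have hSn : |S σ| ≤ c₁ * n := by
      refine abs_le_of_sq_le_sq ?_ (by positivity)
      have : ε * (n : ℝ) ^ 2 ≤ c₁ ^ 2 * n ^ 2 := by gcongr; exact min_le_left _ _
      rw [mul_pow]
      linarith
    refine mul_add_sq_le_quadForm_negHess hK0 (fun i => ?_) v
      (add_sq_le_of_correlated (b := mag A (resid A x θ₀ β₀ σ)) (ε := ε) hn0 hqmin hc₁0 ?_
        (hmag σ) (abs_mag_le hA hrow zero_le_two (abs_resid_le σ))
        (fun u => quadForm_gram (x := x) u ▸ hgram u) ?_ ?_ (fun k => v (.inl k)) (v (.inr ())))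
    · refine (abs_add_le _ _).trans ?_
      linarith [hβm β hβ σ i, hlin θ hθ i]
    · linarith [min_le_right (c₁ ^ 2) (qmin * c₁ ^ 2 / 8)]
    · rw [sum_mag_conf_mul_mag_resid]
      have h1 : 2 * c₁ * n ≤ ∑ j, (∑ i, A i j ^ 2) * (resid A x θ₀ β₀ σ j * conf σ j) := by
        calc 2 * c₁ * n = c * n * (1 / (2 * Real.cosh a ^ 2)) := by
              rw [hc₁]; field_simp; norm_num
          _ ≤ (∑ i, ∑ j, A i j ^ 2) * (1 / (2 * Real.cosh a ^ 2)) := by gcongr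
          _ = ∑ j, (∑ i, A i j ^ 2) * (1 / (2 * Real.cosh a ^ 2)) := by
              rw [Finset.sum_comm, Finset.sum_mul]
          _ ≤ _ := Finset.sum_le_sum fun j _ => by
              refine mul_le_mul_of_nonneg_left (resid_mul_conf_ge σ j ?_)
                (Finset.sum_nonneg fun i _ => sq_nonneg _)
              refine (abs_add_le _ _).trans ?_
              have h2 := hβm β₀ hβ₀ σ j
              rw [mul_assoc, abs_mul, abs_of_pos (two_pos (α := ℝ))]
              linarith [hlin θ₀ hθ₀ j]
      linarith [(abs_le.1 hSn).1]
    · linarith [sq_nonneg (S σ)]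
  · have hS2 := sum_isingWt_mul_offDiag_sq_le (x := x) (θ := θ₀) hA h0 hrow hβ₀
    have hR2 : ∀ k, ∑ σ, isingWt A x θ₀ β₀ σ * R k σ ^ 2
        ≤ (2 + 4 * B) * M ^ 2 * n * ∑ σ, isingWt A x θ₀ β₀ σ := fun k =>
      sum_isingWt_mul_feature_sq_le hA h0 hrow hβ₀ hM.le fun i => hx i k
    have hW : 0 < ∑ σ, isingWt A x θ₀ β₀ σ :=
      Finset.sum_pos (fun σ _ => isingWt_pos σ) Finset.univ_nonempty
    have hsum : ∑ σ, isingWt A x θ₀ β₀ σ * (S σ ^ 2 + ∑ k, R k σ ^ 2)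
        ≤ C * n * ∑ σ, isingWt A x θ₀ β₀ σ := by
      simp only [mul_add, Finset.sum_add_distrib, Finset.mul_sum]
      rw [Finset.sum_comm (s := Finset.univ (α := Fin n → Bool)) (t := Finset.univ (α := Fin d))]
      have h1 := Finset.sum_le_sum fun k (_ : k ∈ Finset.univ) => hR2 k
      rw [Finset.sum_const, Finset.card_univ, Fintype.card_fin, nsmul_eq_mul] at h1
      rw [← Finset.mul_sum]
      refine (add_le_add hS2 h1).trans_eq ?_
      rw [hC]; ring
    simp only [mul_div_assoc']
    rw [← Finset.sum_div, div_le_iff₀ (by positivity)]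
    calc _ ≤ C * n * ∑ σ, isingWt A x θ₀ β₀ σ := hsum
      _ ≤ δ * (ε * n ^ 2) * ∑ σ, isingWt A x θ₀ β₀ σ := by gcongr
      _ = _ := by ring
end
end

section
/- Index selection lemma (sum of large matched entries): Let W be an n×n real matrix such that every row of W has ℓ1-norm at most 1, every column of W has ℓ2-norm at most 1, and ‖W‖_F² ≥ cn for a constant c ∈ (0,1]. Then, for all sufficiently large n, there exists a bijection h : {1,…,n} → {1,…,n} such that Σ_{i=1}^n (W_{i,h(i)})² ≥ c⁴ n / 16. -/
noncomputable section

open Finset in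
/-- A nonnegative matrix with row and column sums at most `1` is dominated entrywise by a doubly
stochastic matrix. -/
theorem exists_doublyStochastic_ge {ι : Type*} [Fintype ι] [DecidableEq ι] (P : Matrix ι ι ℝ)
    (h0 : ∀ i j, 0 ≤ P i j) (hr : ∀ i, ∑ j, P i j ≤ 1) (hs : ∀ j, ∑ i, P i j ≤ 1) :
    ∃ M ∈ doublyStochastic ℝ ι, ∀ i j, P i j ≤ M i j := by
  set r : ι → ℝ := fun i => 1 - ∑ j, P i j with hrdef
  set s : ι → ℝ := fun j => 1 - ∑ i, P i j with hsdef
  have hr0 : ∀ i, 0 ≤ r i := fun i => sub_nonneg.2 (hr i)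
  have hs0 : ∀ j, 0 ≤ s j := fun j => sub_nonneg.2 (hs j)
  have hsum : ∑ i, r i = ∑ j, s j := by
    simp only [hrdef, hsdef, sum_sub_distrib]
    rw [sum_comm]
  have hcancel : ∀ {f : ι → ℝ}, (∀ i, 0 ≤ f i) → ∀ i, f i * (∑ k, f k) / (∑ k, f k) = f i := by
    intro f hf i
    refine mul_div_cancel_of_imp fun h => ?_
    exact (sum_eq_zero_iff_of_nonneg fun k _ => hf k).1 h i (mem_univ i)
  have hadd : ∀ i j, 0 ≤ r i * s j / ∑ k, r k := fun i j =>
    div_nonneg (mul_nonneg (hr0 i) (hs0 j)) (sum_nonneg fun k _ => hr0 k)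
  refine ⟨Matrix.of fun i j => P i j + r i * s j / ∑ k, r k, ?_, fun i j =>
    le_add_of_nonneg_right (hadd i j)⟩
  rw [mem_doublyStochastic_iff_sum]
  refine ⟨fun i j => add_nonneg (h0 i j) (hadd i j), fun i => ?_, fun j => ?_⟩ <;>
    simp only [Matrix.of_apply]
  · rw [sum_add_distrib, ← sum_div, ← mul_sum, ← hsum, hcancel hr0]
    simp [hrdef]
  · rw [sum_add_distrib, ← sum_div, ← sum_mul, mul_comm, hsum, hcancel hs0]
    simp [hsdef]

open Finset in
/-- The average of `A` against a doubly stochastic matrix is at most the value of `A` on some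
permutation. -/
theorem exists_perm_sum_ge_of_mem_doublyStochastic {ι : Type*} [Fintype ι] [DecidableEq ι]
    {M : Matrix ι ι ℝ} (hM : M ∈ doublyStochastic ℝ ι) (A : Matrix ι ι ℝ) :
    ∃ σ : Equiv.Perm ι, ∑ i, ∑ j, M i j * A i j ≤ ∑ i, A i (σ i) := by
  obtain ⟨w, hw0, hw1, rfl⟩ := exists_eq_sum_perm_of_mem_doublyStochastic hM
  have key : ∑ i, ∑ j, (∑ σ, w σ • σ.permMatrix ℝ) i j * A i j
      = ∑ σ : Equiv.Perm ι, w σ * ∑ i, A i (σ i) := by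
    simp only [Matrix.sum_apply, Matrix.smul_apply, Equiv.Perm.permMatrix,
      PEquiv.toMatrix_apply, Equiv.toPEquiv_apply, Option.mem_some_iff, smul_eq_mul, sum_mul]
    simp_rw [sum_comm (s := univ (α := ι)) (t := univ (α := Equiv.Perm ι)), mul_sum]
    simp
  by_contra! h
  rw [key] at h
  have hall : ∀ τ ∈ univ, w τ * ∑ i, A i (τ i) ≤ w τ * ∑ τ, w τ * ∑ i, A i (τ i) :=
    fun τ _ => mul_le_mul_of_nonneg_left (h τ).le (hw0 τ)
  obtain ⟨τ, -, hτ⟩ := exists_ne_zero_of_sum_ne_zero (hw1.symm ▸ one_ne_zero : ∑ τ, w τ ≠ 0)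
  have hlt := sum_lt_sum hall
    ⟨τ, mem_univ τ, mul_lt_mul_of_pos_left (h τ) ((hw0 τ).lt_of_ne' hτ)⟩
  rw [← sum_mul, hw1, one_mul] at hlt
  exact lt_irrefl _ hlt

/-- The tangent-line bound `3c²x² - 2c³|x| ≤ x⁴`. -/
theorem three_mul_sq_sub_le_pow_four {c : ℝ} (hc : 0 ≤ c) (x : ℝ) :
    3 * c ^ 2 * x ^ 2 - 2 * c ^ 3 * |x| ≤ x ^ 2 * x ^ 2 := by
  have h : 0 ≤ |x| * ((|x| - c) ^ 2 * (|x| + 2 * c)) := by positivity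
  rw [← sq_abs x]
  linarith

/-- **Index selection lemma: sum of large matched entries.** Let `W` be an
`n×n` real matrix all of whose rows have ℓ1-norm at most 1, all of whose columns have
ℓ2-norm at most 1, and with `‖W‖_F² ≥ cn` for a constant `c ∈ (0,1]`. Then, for all
sufficiently large `n`, there is a bijection `h` of `{1,…,n}` with
`Σ_i (W_{i,h(i)})² ≥ c⁴ n / 16`. -/
theorem statement9 (c : ℝ) (hc0 : 0 < c) (hc1 : c ≤ 1) :
    ∃ N : ℕ, ∀ n : ℕ, N ≤ n → ∀ W : Matrix (Fin n) (Fin n) ℝ,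
      (∀ i, ∑ j, |W i j| ≤ 1) →
      (∀ j, Real.sqrt (∑ i, (W i j)^2) ≤ 1) →
      (c * n ≤ ∑ i, ∑ j, (W i j)^2) →
      ∃ h : Equiv.Perm (Fin n), c^4 * n / 16 ≤ ∑ i, (W i (h i))^2 := by
  refine ⟨0, fun n _ W hrow hcol hF => ?_⟩
  have hsqrow : ∀ i, ∑ j, (W i j) ^ 2 ≤ 1 := fun i => by
    refine (Finset.sum_le_sum fun j _ => ?_).trans (hrow i)
    have hle : |W i j| ≤ 1 :=
      (Finset.single_le_sum (fun k _ => abs_nonneg (W i k)) (Finset.mem_univ j)).trans (hrow i)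
    rw [← sq_abs]
    exact pow_le_of_le_one (abs_nonneg _) hle two_ne_zero
  have hsqcol : ∀ j, ∑ i, (W i j) ^ 2 ≤ 1 := fun j => by simpa using hcol j
  obtain ⟨M, hM, hWM⟩ := exists_doublyStochastic_ge (W.map (· ^ 2))
    (by simp [sq_nonneg]) (by simpa using hsqrow) (by simpa using hsqcol)
  obtain ⟨σ, hσ⟩ := exists_perm_sum_ge_of_mem_doublyStochastic hM (W.map (· ^ 2))
  simp only [Matrix.map_apply] at hWM hσ
  refine ⟨σ, le_trans ?_ hσ⟩
  have hl1 : ∑ i, ∑ j, |W i j| ≤ n := by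
    simpa using Finset.sum_le_sum fun i (_ : i ∈ Finset.univ) => hrow i
  have hc3 : 0 < c ^ 3 := pow_pos hc0 3
  calc c ^ 4 * n / 16 ≤ c ^ 3 * n := by
        have h4 : c ^ 4 ≤ c ^ 3 := pow_le_pow_of_le_one hc0.le hc1 (by norm_num)
        have hn : (0 : ℝ) ≤ n := n.cast_nonneg
        linarith [mul_le_mul_of_nonneg_right h4 hn, mul_nonneg hc3.le hn]
    _ ≤ 3 * c ^ 2 * ∑ i, ∑ j, (W i j) ^ 2 - 2 * c ^ 3 * ∑ i, ∑ j, |W i j| := by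
        linarith [mul_le_mul_of_nonneg_left hF (sq_nonneg c), mul_le_mul_of_nonneg_left hl1 hc3.le]
    _ = ∑ i, ∑ j, (3 * c ^ 2 * (W i j) ^ 2 - 2 * c ^ 3 * |W i j|) := by
        simp only [Finset.sum_sub_distrib, Finset.mul_sum]
    _ ≤ ∑ i, ∑ j, M i j * (W i j) ^ 2 := by
        gcongr with i _ j _
        exact (three_mul_sq_sub_le_pow_four hc0.le _).trans
          (mul_le_mul_of_nonneg_right (hWM i j) (sq_nonneg _))
end
end

section
/- Frobenius norm loss under projection: If P is an orthogonal projection on ℝⁿ of rank n − d (i.e., P is symmetric, P² = P, with exactly d zero eigenvalues and n−d eigenvalues equal to 1), and A is an n×n real matrix with ‖A‖₂ ≤ 1 (operator norm), then ‖PA‖_F² ≥ ‖A‖_F² − d. -/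
noncomputable section

/-- Spectral (ℓ2 operator) norm of a square real matrix. -/
def specNorm {m : ℕ} (M : Matrix (Fin m) (Fin m) ℝ) : ℝ :=
  ‖(Matrix.toEuclideanCLM (𝕜 := ℝ) (n := Fin m)) M‖

open Matrix

/-- The squared Frobenius norm is the trace of the Gram matrix of the rows. -/
lemma sum_sq_eq_trace_mul_transpose {m n : Type*} [Fintype m] [Fintype n] (M : Matrix m n ℝ) :
    ∑ i, ∑ j, M i j ^ 2 = (M * Mᵀ).trace := by
  simp [Matrix.trace, Matrix.mul_apply, sq]

lemma IsIdempotentElem.matrix_trace_eq_rank {n K : Type*} [Fintype n] [DecidableEq n] [Field K]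
    {P : Matrix n n K} (hP : IsIdempotentElem P) : P.trace = P.rank := by
  have h : IsIdempotentElem (Matrix.toLin' P) := by
    rw [IsIdempotentElem, Module.End.mul_eq_comp, ← Matrix.toLin'_mul, hP.eq]
  rw [← Matrix.trace_toLin'_eq, (LinearMap.IsIdempotentElem.isProj_range _ h).trace]
  rfl

lemma IsIdempotentElem.sum_sq_mul_eq_trace {m n : Type*} [Fintype m] [Fintype n]
    {P : Matrix m m ℝ} (hP : IsIdempotentElem P) (hsym : P.IsSymm) (A : Matrix m n ℝ) :
    ∑ i, ∑ j, (P * A) i j ^ 2 = (P * (A * Aᵀ)).trace := by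
  rw [sum_sq_eq_trace_mul_transpose, Matrix.transpose_mul, hsym.eq, ← Matrix.mul_assoc,
    Matrix.trace_mul_comm, ← Matrix.mul_assoc, ← Matrix.mul_assoc, hP.eq, Matrix.mul_assoc]

open scoped Matrix.Norms.L2Operator in
lemma sum_sq_vecMul_le {m : ℕ} {A : Matrix (Fin m) (Fin m) ℝ} (hA : specNorm A ≤ 1)
    (v : Fin m → ℝ) : ∑ j, (v ᵥ* A) j ^ 2 ≤ ∑ j, v j ^ 2 := by
  have hAT : ‖Aᵀ‖ ≤ 1 := by
    rw [← Matrix.conjTranspose_eq_transpose_of_trivial, Matrix.l2_opNorm_conjTranspose]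
    exact hA
  have h := (Matrix.l2_opNorm_mulVec Aᵀ (WithLp.toLp 2 v)).trans
    (mul_le_of_le_one_left (norm_nonneg _) hAT)
  have h2 := pow_le_pow_left₀ (norm_nonneg _) h 2
  simpa [EuclideanSpace.norm_sq_eq, Matrix.mulVec_transpose] using h2

lemma sum_sq_mul_le {m : ℕ} {ι : Type*} [Fintype ι] {A : Matrix (Fin m) (Fin m) ℝ}
    (hA : specNorm A ≤ 1) (M : Matrix ι (Fin m) ℝ) :
    ∑ i, ∑ j, (M * A) i j ^ 2 ≤ ∑ i, ∑ j, M i j ^ 2 :=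
  Finset.sum_le_sum fun i _ => sum_sq_vecMul_le hA (M i)

/-- **Frobenius norm loss under projection.** If `P` is an orthogonal
projection on `ℝⁿ` of rank `n − d` (symmetric, idempotent, with exactly `d` zero
eigenvalues and `n−d` eigenvalues 1), and `A` is an `n×n` matrix with `‖A‖₂ ≤ 1`,
then `‖PA‖_F² ≥ ‖A‖_F² − d`. -/
theorem statement13 (n d : ℕ) (P A : Matrix (Fin n) (Fin n) ℝ)
    (hsym : P.IsSymm) (hidem : P * P = P) (hrank : P.rank = n - d) (hdn : d ≤ n)
    (hA : specNorm A ≤ 1) :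
    (∑ i, ∑ j, (A i j)^2) - d ≤ ∑ i, ∑ j, ((P * A) i j)^2 := by
  have hP : IsIdempotentElem P := hidem
  have hQ : IsIdempotentElem (1 - P) := hP.one_sub
  have hQsym : (1 - P).IsSymm := Matrix.isSymm_one.sub hsym
  have hle := sum_sq_mul_le hA (1 - P)
  have hQtrace : ∑ i, ∑ j, (1 - P) i j ^ 2 = (d : ℝ) := by
    rw [sum_sq_eq_trace_mul_transpose, hQsym.eq, hQ.eq, Matrix.trace_sub, Matrix.trace_one,
      hP.matrix_trace_eq_rank, hrank, Nat.cast_sub hdn, Fintype.card_fin, sub_sub_cancel]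
  rw [hQtrace, hQ.sum_sq_mul_eq_trace hQsym, sub_mul, one_mul, Matrix.trace_sub] at hle
  rw [hP.sum_sq_mul_eq_trace hsym, sum_sq_eq_trace_mul_transpose]
  linarith
end
end

section
/- The Sherrington–Kirkpatrick interaction matrix satisfies the assumptions for consistent estimation: Let g_{ij}, 1 ≤ i < j ≤ n, be i.i.d. standard Gaussian random variables, and define the symmetric n×n matrix A by A_{ij} = A_{ji} = g_{ij}/√n for i < j and A_{ii} = 0. Then there exist absolute constants C₀, c₀ > 0 such that, with probability tending to 1 as n → ∞: (i) ‖A‖₂ ≤ C₀; (ii) ‖A‖_F² ≥ c₀ n. Moreover, if X is an n×d random matrix, independent of A, whose rows are i.i.d. subgaussian vectors in ℝ^d with second moment matrix Q satisfying λ_min(Q) > 0, and which satisfies (1/√n)‖X‖₂ < 1/(2‖A‖₂²), then with probability tending to 1 as n → ∞ (with d fixed), λ_min( (1/n) Xᵀ Aᵀ F A X ) ≥ λ_min(Q) − o(1) > 0, where F = I − X(XᵀX)⁻¹Xᵀ. -/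
open MeasureTheory Matrix

noncomputable section

/-- Law of the i.i.d. standard Gaussian array `(g_{ij})_{i,j}`. -/
def gaussArray (n : ℕ) : Measure (Fin n → Fin n → ℝ) :=
  Measure.pi fun _ => Measure.pi fun _ => ProbabilityTheory.gaussianReal 0 1

/-- The Sherrington–Kirkpatrick interaction matrix built from the Gaussian array:
`A_{ij} = A_{ji} = g_{ij}/√n` for `i < j`, `A_{ii} = 0`. -/
def skA (n : ℕ) (ω : Fin n → Fin n → ℝ) : Matrix (Fin n) (Fin n) ℝ :=
  Matrix.of fun i j =>
    if i < j then ω i j / Real.sqrt n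
    else if j < i then ω j i / Real.sqrt n else 0

/-- Spectral (ℓ2 operator) norm of a rectangular real matrix. -/
def opNorm {a b : ℕ} (M : Matrix (Fin a) (Fin b) ℝ) : ℝ :=
  ‖LinearMap.toContinuousLinearMap (Matrix.toEuclideanLin M)‖

/-- Smallest eigenvalue of a symmetric matrix, as the infimum of its quadratic form
over the unit sphere. -/
def lamMin {d : ℕ} (M : Matrix (Fin d) (Fin d) ℝ) : ℝ :=
  ⨅ v : {v : Fin d → ℝ // ∑ k, (v k)^2 = 1}, v.1 ⬝ᵥ M.mulVec v.1

/-- Second moment matrix `Q` of a distribution `ν` on `ℝ^d`. -/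
def secondMoment {d : ℕ} (ν : Measure (Fin d → ℝ)) : Matrix (Fin d) (Fin d) ℝ :=
  Matrix.of fun k l => ∫ x, x k * x l ∂ν

section SKEstimates

open ProbabilityTheory
open scoped NNReal ENNReal

theorem hasLaw_sum_pi_gaussianReal {ι : Type*} [Fintype ι] {E : ι → Type*}
    [∀ i, MeasurableSpace (E i)] (μ : ∀ i, Measure (E i)) [∀ i, IsProbabilityMeasure (μ i)]
    (f : ∀ i, E i → ℝ) (v : ι → ℝ≥0) (h : ∀ i, HasLaw (f i) (gaussianReal 0 (v i)) (μ i)) :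
    HasLaw (fun ω : ∀ i, E i => ∑ i, f i (ω i)) (gaussianReal 0 (∑ i, v i)) (Measure.pi μ) := by
  have hf : ∀ i, HasLaw (fun ω : ∀ i, E i => f i (ω i)) (gaussianReal 0 (v i)) (Measure.pi μ) :=
    fun i => (h i).comp (measurePreserving_eval μ i).hasLaw
  have hind : iIndepFun (fun i (ω : ∀ i, E i) => f i (ω i)) (Measure.pi μ) :=
    iIndepFun_pi fun i => (h i).aemeasurable
  have hg : HasGaussianLaw (fun ω : ∀ i, E i => ∑ i, f i (ω i)) (Measure.pi μ) :=
    iIndepFun.hasGaussianLaw_fun_sum (fun i => (hf i).hasGaussianLaw) hind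
  have hmean : ∀ i, ∫ ω, f i (ω i) ∂(Measure.pi μ) = 0 := fun i => by
    rw [(hf i).integral_eq]; simp
  have hvar : ∀ i, Var[fun ω : ∀ i, E i => f i (ω i); Measure.pi μ] = v i := fun i => by
    rw [(hf i).variance_eq]; simp
  refine ⟨hg.aemeasurable, ?_⟩
  rw [hg.map_eq_gaussianReal]
  congr 1
  · rw [integral_finsetSum _ fun i _ => (hf i).hasGaussianLaw.integrable]
    simp [hmean]
  · have := variance_sum_pi (μ := μ) (X := f) fun i => (h i).hasGaussianLaw.memLp_two
    have h2 : Var[fun ω : ∀ i, E i => ∑ i, f i (ω i); Measure.pi μ] = ((∑ i, v i : ℝ≥0) : ℝ) := by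
      convert! this using 1
      · congr 1; ext; simp
      · push_cast
        refine Finset.sum_congr rfl fun i _ => ?_
        rw [(h i).variance_eq]; simp
    rw [h2, Real.toNNReal_coe]

theorem integral_sq_gaussianReal (v : ℝ≥0) : ∫ x, x ^ 2 ∂(gaussianReal 0 v) = v := by
  have := variance_fun_id_gaussianReal (μ := 0) (v := v)
  rwa [variance_of_integral_eq_zero (by fun_prop) (by simp)] at this

theorem integral_pow_four_gaussianReal (v : ℝ≥0) :
    ∫ x, x ^ 4 ∂(gaussianReal 0 v) = 3 * (v : ℝ) ^ 2 := by
  have h := iteratedDeriv_mgf_zero (X := id) (μ := gaussianReal 0 v) (by simp) 4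
  have e0 : mgf id (gaussianReal 0 v) = fun t : ℝ => 1 * Real.exp (v * t ^ 2 / 2) := by
    rw [mgf_id_gaussianReal]; simp
  have step : ∀ p q : ℝ → ℝ, (∀ t, HasDerivAt p (q t) t) →
      deriv (fun t : ℝ => p t * Real.exp (v * t ^ 2 / 2))
        = fun t => (q t + v * t * p t) * Real.exp (v * t ^ 2 / 2) := by
    intro p q hp
    ext t
    have h1 : HasDerivAt (fun t : ℝ => (v : ℝ) * t ^ 2 / 2) (v * t) t := by
      convert! (((hasDerivAt_id t).pow 2).const_mul (v : ℝ)).div_const 2 using 1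
      simp; ring
    exact ((hp t).mul h1.exp).deriv.trans (by ring)
  have d1 := step (fun _ => 1) (fun _ => 0) fun t => hasDerivAt_const _ _
  have d2 := step (fun t => 0 + v * t * 1) (fun _ => v) fun t => by
    convert! ((hasDerivAt_id t).const_mul (v : ℝ)) using 1 <;> [(ext; simp); simp]
  have d3 := step (fun t => v + v * t * (0 + v * t * 1)) (fun t => 2 * v ^ 2 * t) fun t => by
    convert! (((hasDerivAt_id t).pow 2).const_mul ((v : ℝ) ^ 2)).const_add (v : ℝ) using 1
    · ext; simp; ring
    · simp; ring
  have d4 := step (fun t => 2 * v ^ 2 * t + v * t * (v + v * t * (0 + v * t * 1)))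
      (fun t => 3 * v ^ 2 + 3 * v ^ 3 * t ^ 2) fun t => by
    convert! ((hasDerivAt_id t).const_mul (3 * (v : ℝ) ^ 2)).add
      (((hasDerivAt_id t).pow 3).const_mul ((v : ℝ) ^ 3)) using 1
    · ext; simp; ring
    · simp; ring
  rw [iteratedDeriv_succ, iteratedDeriv_succ, iteratedDeriv_succ, iteratedDeriv_one, e0, d1, d2,
    d3, d4] at h
  simpa using h.symm

/-- The linear functional `∑ c_{ij} ω_{ij}` of a square array. -/
def gaussForm {n : ℕ} (c ω : Fin n → Fin n → ℝ) : ℝ := ∑ i, ∑ j, c i j * ω i j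

instance (n : ℕ) : IsProbabilityMeasure (gaussArray n) := by
  unfold gaussArray; infer_instance

theorem gaussForm_add {n : ℕ} (a b ω : Fin n → Fin n → ℝ) :
    gaussForm (a + b) ω = gaussForm a ω + gaussForm b ω := by
  simp [gaussForm, add_mul, Finset.sum_add_distrib]

theorem gaussForm_sub {n : ℕ} (a b ω : Fin n → Fin n → ℝ) :
    gaussForm (a - b) ω = gaussForm a ω - gaussForm b ω := by
  simp [gaussForm, sub_mul, Finset.sum_sub_distrib]

theorem gaussForm_comm {n : ℕ} (a b : Fin n → Fin n → ℝ) : gaussForm a b = gaussForm b a := by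
  simp [gaussForm, mul_comm]

theorem gaussForm_self_nonneg {n : ℕ} (c : Fin n → Fin n → ℝ) : 0 ≤ gaussForm c c :=
  Finset.sum_nonneg fun _ _ => Finset.sum_nonneg fun _ _ => mul_self_nonneg _

theorem hasLaw_gaussForm {n : ℕ} (c : Fin n → Fin n → ℝ) :
    HasLaw (gaussForm c) (gaussianReal 0 (gaussForm c c).toNNReal) (gaussArray n) := by
  have h := hasLaw_sum_pi_gaussianReal (fun _ : Fin n => Measure.pi fun _ : Fin n => gaussianReal 0 1)
    (fun i x => ∑ j, c i j * x j) (fun i => ∑ j, ‖c i j‖₊ ^ 2) fun i =>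
      hasLaw_sum_pi_gaussianReal (fun _ : Fin n => gaussianReal 0 1) (fun j x => c i j * x)
        (fun j => ‖c i j‖₊ ^ 2) fun j => by
          have := gaussianReal_const_mul (HasLaw.id (μ := gaussianReal 0 1)) (c i j)
          rw [mul_zero, mul_one] at this
          convert! this using 2
          apply NNReal.coe_injective
          simp
  convert! h using 2
  apply NNReal.coe_injective
  rw [Real.coe_toNNReal _ (gaussForm_self_nonneg c)]
  simp [gaussForm, ← sq]

theorem integrable_gaussForm_pow {n : ℕ} (c : Fin n → Fin n → ℝ) (k : ℕ) :
    Integrable (fun ω => gaussForm c ω ^ k) (gaussArray n) := by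
  have := ((hasLaw_gaussForm c).hasGaussianLaw.memLp (p := k) (by simp)).integrable_norm_pow'
  refine this.mono' ?_ ?_
  · exact ((hasLaw_gaussForm c).aemeasurable.pow_const k).aestronglyMeasurable
  · simp

theorem integral_gaussForm_sq {n : ℕ} (c : Fin n → Fin n → ℝ) :
    ∫ ω, gaussForm c ω ^ 2 ∂(gaussArray n) = gaussForm c c := by
  have h := (hasLaw_gaussForm c).integral_comp (f := fun x => x ^ 2) (by fun_prop)
  rwa [integral_sq_gaussianReal, Real.coe_toNNReal _ (gaussForm_self_nonneg c)] at h

theorem integral_gaussForm_pow_four {n : ℕ} (c : Fin n → Fin n → ℝ) :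
    ∫ ω, gaussForm c ω ^ 4 ∂(gaussArray n) = 3 * gaussForm c c ^ 2 := by
  have h := (hasLaw_gaussForm c).integral_comp (f := fun x => x ^ 4) (by fun_prop)
  rwa [integral_pow_four_gaussianReal, Real.coe_toNNReal _ (gaussForm_self_nonneg c)] at h

theorem gaussForm_sq_mul_sq {n : ℕ} (a b ω : Fin n → Fin n → ℝ) :
    gaussForm a ω ^ 2 * gaussForm b ω ^ 2 =
      (gaussForm (a + b) ω ^ 4 + gaussForm (a - b) ω ^ 4
        - 2 * gaussForm a ω ^ 4 - 2 * gaussForm b ω ^ 4) / 12 := by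
  rw [gaussForm_add, gaussForm_sub]; ring

theorem integrable_gaussForm_sq_mul_sq {n : ℕ} (a b : Fin n → Fin n → ℝ) :
    Integrable (fun ω => gaussForm a ω ^ 2 * gaussForm b ω ^ 2) (gaussArray n) := by
  simp_rw [gaussForm_sq_mul_sq]
  have i4 := fun c : Fin n → Fin n → ℝ => integrable_gaussForm_pow c 4
  fun_prop

theorem integral_gaussForm_sq_mul_sq {n : ℕ} (a b : Fin n → Fin n → ℝ) :
    ∫ ω, gaussForm a ω ^ 2 * gaussForm b ω ^ 2 ∂(gaussArray n)
      = gaussForm a a * gaussForm b b + 2 * gaussForm a b ^ 2 := by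
  have i4 := fun c : Fin n → Fin n → ℝ => integrable_gaussForm_pow c 4
  simp_rw [gaussForm_sq_mul_sq]
  rw [integral_div, integral_sub (by fun_prop) (by fun_prop),
    integral_sub (by fun_prop) (by fun_prop), integral_add (i4 _) (i4 _),
    integral_const_mul, integral_const_mul]
  simp only [integral_gaussForm_pow_four]
  have h1 : gaussForm (a + b) (a + b) = gaussForm a a + 2 * gaussForm a b + gaussForm b b := by
    rw [gaussForm_add, gaussForm_comm a, gaussForm_comm b, gaussForm_add, gaussForm_add,
      gaussForm_comm b a]; ring
  have h2 : gaussForm (a - b) (a - b) = gaussForm a a - 2 * gaussForm a b + gaussForm b b := by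
    rw [gaussForm_sub, gaussForm_comm a, gaussForm_comm b, gaussForm_sub, gaussForm_sub,
      gaussForm_comm b a]; ring
  rw [h1, h2]; ring

/-- The covariance of the squares of two Gaussian linear functionals. -/
theorem integral_gaussForm_sq_sub_mul {n : ℕ} (a b : Fin n → Fin n → ℝ) :
    Integrable (fun ω => (gaussForm a ω ^ 2 - gaussForm a a) * (gaussForm b ω ^ 2 - gaussForm b b))
      (gaussArray n) ∧
    ∫ ω, (gaussForm a ω ^ 2 - gaussForm a a) * (gaussForm b ω ^ 2 - gaussForm b b) ∂(gaussArray n)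
      = 2 * gaussForm a b ^ 2 := by
  have e : (fun ω => (gaussForm a ω ^ 2 - gaussForm a a) * (gaussForm b ω ^ 2 - gaussForm b b))
      = fun ω => gaussForm a ω ^ 2 * gaussForm b ω ^ 2 - gaussForm b b * gaussForm a ω ^ 2
        - gaussForm a a * gaussForm b ω ^ 2 + gaussForm a a * gaussForm b b := by
    ext ω; ring
  have i1 := integrable_gaussForm_sq_mul_sq a b
  have i2 := (integrable_gaussForm_pow a 2).const_mul (gaussForm b b)
  have i3 := (integrable_gaussForm_pow b 2).const_mul (gaussForm a a)
  have i4 : Integrable (fun _ => gaussForm a a * gaussForm b b) (gaussArray n) :=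
    integrable_const _
  rw [e]
  refine ⟨by fun_prop, ?_⟩
  rw [integral_add (by fun_prop) i4, integral_sub (by fun_prop) i3, integral_sub i1 i2,
    integral_const_mul, integral_const_mul, integral_gaussForm_sq, integral_gaussForm_sq,
    integral_gaussForm_sq_mul_sq]
  simp; ring

/-- The variance of a sum of squares of Gaussian linear functionals. -/
theorem integral_sum_gaussForm_sq_sub {n : ℕ} {κ : Type*} [Fintype κ] (c : κ → Fin n → Fin n → ℝ) :
    Integrable (fun ω => (∑ k, gaussForm (c k) ω ^ 2 - ∑ k, gaussForm (c k) (c k)) ^ 2)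
      (gaussArray n) ∧
    ∫ ω, (∑ k, gaussForm (c k) ω ^ 2 - ∑ k, gaussForm (c k) (c k)) ^ 2 ∂(gaussArray n)
      = 2 * ∑ k, ∑ l, gaussForm (c k) (c l) ^ 2 := by
  have e : (fun ω => (∑ k, gaussForm (c k) ω ^ 2 - ∑ k, gaussForm (c k) (c k)) ^ 2)
      = fun ω => ∑ k, ∑ l, (gaussForm (c k) ω ^ 2 - gaussForm (c k) (c k))
        * (gaussForm (c l) ω ^ 2 - gaussForm (c l) (c l)) := by
    ext ω
    rw [← Finset.sum_sub_distrib, sq, Finset.sum_mul_sum]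
  have hi := fun k l => integral_gaussForm_sq_sub_mul (c k) (c l)
  rw [e]
  refine ⟨integrable_finsetSum _ fun k _ => integrable_finsetSum _ fun l _ => (hi k l).1, ?_⟩
  rw [integral_finsetSum _ fun k _ => integrable_finsetSum _ fun l _ => (hi k l).1,
    Finset.mul_sum]
  refine Finset.sum_congr rfl fun k _ => ?_
  rw [integral_finsetSum _ fun l _ => (hi k l).1, Finset.mul_sum]
  exact Finset.sum_congr rfl fun l _ => (hi k l).2

theorem measureReal_abs_ge_le_of_integral_sq_le {Ω : Type*} [MeasurableSpace Ω] {μ : Measure Ω}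
    [IsFiniteMeasure μ] {Z : Ω → ℝ} (hi : Integrable (fun ω => Z ω ^ 2) μ) {B t : ℝ} (ht : 0 < t)
    (hB : ∫ ω, Z ω ^ 2 ∂μ ≤ B) : μ.real {ω | t ≤ |Z ω|} ≤ B / t ^ 2 := by
  have h := mul_meas_ge_le_integral_of_nonneg (Filter.Eventually.of_forall fun ω => sq_nonneg (Z ω))
    hi (t ^ 2)
  have e : {ω | t ≤ |Z ω|} = {ω | t ^ 2 ≤ Z ω ^ 2} := by
    ext ω
    rw [Set.mem_ofPred_eq, Set.mem_ofPred_eq, sq_le_sq, abs_of_pos ht]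
  rw [e, le_div_iff₀ (by positivity), mul_comm]
  exact h.trans hB

/-- The coefficients of `y ⬝ᵥ A *ᵥ x` as a linear functional of the Gaussian array. -/
def skCoef {n : ℕ} (y x : Fin n → ℝ) : Fin n → Fin n → ℝ := fun p q =>
  if p < q then (y p * x q + y q * x p) / Real.sqrt n else 0

theorem dotProduct_skA_mulVec {n : ℕ} (ω : Fin n → Fin n → ℝ) (y x : Fin n → ℝ) :
    y ⬝ᵥ (skA n ω).mulVec x = gaussForm (skCoef y x) ω := by
  have e : y ⬝ᵥ (skA n ω).mulVec x
      = ∑ p, ∑ q, ((if p < q then y p * x q / Real.sqrt n * ω p q else 0)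
        + (if q < p then y p * x q / Real.sqrt n * ω q p else 0)) := by
    simp only [dotProduct, mulVec, Finset.mul_sum]
    refine Finset.sum_congr rfl fun p _ => Finset.sum_congr rfl fun q _ => ?_
    rcases lt_trichotomy p q with h | h | h
    · simp [skA, h, h.not_gt]; ring
    · simp [skA, h]
    · simp [skA, h, h.not_gt]; ring
  simp_rw [e, Finset.sum_add_distrib]
  rw [add_comm, Finset.sum_comm, ← Finset.sum_add_distrib]
  simp_rw [← Finset.sum_add_distrib]
  refine Finset.sum_congr rfl fun p _ => Finset.sum_congr rfl fun q _ => ?_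
  by_cases h : p < q
  · simp [skCoef, h]; ring
  · simp [skCoef, h]

theorem sum_sum_lt_of_symm {n : ℕ} (f : Fin n → Fin n → ℝ) (hf : ∀ p q, f p q = f q p) :
    2 * ∑ p, ∑ q, (if p < q then f p q else 0) = ∑ p, ∑ q, f p q - ∑ p, f p p := by
  have h : ∀ p q, f p q = (if p < q then f p q else 0) + (if q < p then f q p else 0)
      + (if p = q then f p p else 0) := by
    intro p q
    rcases lt_trichotomy p q with h | h | h
    · simp [h, h.not_gt, h.ne]
    · simp [h]
    · simp [h, h.not_gt, h.ne', hf q p]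
  have h2 : ∑ p, ∑ q, (if q < p then f q p else 0) = ∑ p, ∑ q, (if p < q then f p q else 0) :=
    Finset.sum_comm
  rw [Finset.sum_congr rfl fun p _ => Finset.sum_congr rfl fun q _ => h p q]
  simp only [Finset.sum_add_distrib]
  rw [h2]
  simp
  ring

theorem gaussForm_skCoef {n : ℕ} (y x z w : Fin n → ℝ) :
    gaussForm (skCoef y x) (skCoef z w) =
      ((y ⬝ᵥ z) * (x ⬝ᵥ w) + (y ⬝ᵥ w) * (x ⬝ᵥ z) - 2 * ∑ p, y p * x p * z p * w p) / n := by
  have e : gaussForm (skCoef y x) (skCoef z w) = (∑ p, ∑ q, (if p < q then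
      (y p * x q + y q * x p) * (z p * w q + z q * w p) else 0)) / n := by
    simp_rw [gaussForm, Finset.sum_div]
    refine Finset.sum_congr rfl fun p _ => Finset.sum_congr rfl fun q _ => ?_
    by_cases h : p < q
    · simp only [skCoef, h, if_true]
      rw [div_mul_div_comm, Real.mul_self_sqrt (by positivity)]
    · simp [skCoef, h]
  have h := sum_sum_lt_of_symm (fun p q => (y p * x q + y q * x p) * (z p * w q + z q * w p))
    fun p q => by ring
  rw [e]
  congr 1
  have h2 : ∑ p, ∑ q, (y p * x q + y q * x p) * (z p * w q + z q * w p)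
      = 2 * ((y ⬝ᵥ z) * (x ⬝ᵥ w) + (y ⬝ᵥ w) * (x ⬝ᵥ z)) := by
    have h3 : ∀ a b c d : Fin n → ℝ, (a ⬝ᵥ b) * (c ⬝ᵥ d) = ∑ p, ∑ q, a p * b p * (c q * d q) :=
      fun a b c d => by simp_rw [dotProduct, Finset.sum_mul_sum]
    have h4 : 2 * ((y ⬝ᵥ z) * (x ⬝ᵥ w) + (y ⬝ᵥ w) * (x ⬝ᵥ z))
      = (y ⬝ᵥ z) * (x ⬝ᵥ w) + (y ⬝ᵥ w) * (x ⬝ᵥ z)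
        + ((x ⬝ᵥ w) * (y ⬝ᵥ z) + (x ⬝ᵥ z) * (y ⬝ᵥ w)) := by ring
    rw [h4]
    simp_rw [h3, ← Finset.sum_add_distrib]
    refine Finset.sum_congr rfl fun p _ => Finset.sum_congr rfl fun q _ => ?_
    ring
  rw [h2] at h
  have h5 : ∑ p, (y p * x p + y p * x p) * (z p * w p + z p * w p)
      = 4 * ∑ p, y p * x p * z p * w p := by
    rw [Finset.mul_sum]
    exact Finset.sum_congr rfl fun p _ => by ring
  simp only [h5] at h
  linarith

theorem dotProduct_sq_le {ι : Type*} [Fintype ι] (x y : ι → ℝ) :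
    (x ⬝ᵥ y) ^ 2 ≤ (x ⬝ᵥ x) * (y ⬝ᵥ y) := by
  simpa [dotProduct, sq] using Finset.sum_mul_sq_le_sq_mul_sq Finset.univ x y

theorem gaussForm_skCoef_self_le {n : ℕ} (y x : Fin n → ℝ) :
    gaussForm (skCoef y x) (skCoef y x) ≤ 2 * ((y ⬝ᵥ y) * (x ⬝ᵥ x)) / n := by
  rw [gaussForm_skCoef]
  gcongr
  have h1 : 0 ≤ ∑ p, y p * x p * y p * x p :=
    Finset.sum_nonneg fun p _ => by nlinarith [sq_nonneg (y p * x p)]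
  have h2 := dotProduct_sq_le y x
  rw [dotProduct_comm x y]
  nlinarith

theorem sq_le_dotProduct_self {ι : Type*} [Fintype ι] (u : ι → ℝ) (i : ι) : u i ^ 2 ≤ u ⬝ᵥ u := by
  rw [sq]
  exact Finset.single_le_sum (f := fun i => u i * u i) (fun j _ => mul_self_nonneg _)
    (Finset.mem_univ i)

/-- The deviation of `|A u|²` from its mean. -/
def skDev {n : ℕ} (ω : Fin n → Fin n → ℝ) (u : Fin n → ℝ) : ℝ :=
  (skA n ω).mulVec u ⬝ᵥ (skA n ω).mulVec u - ((n : ℝ) - 1) / n * (u ⬝ᵥ u)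

theorem integral_skDev_sq_le {n : ℕ} (u : Fin n → ℝ) :
    Integrable (fun ω => skDev ω u ^ 2) (gaussArray n) ∧
      ∫ ω, skDev ω u ^ 2 ∂(gaussArray n) ≤ 8 * (u ⬝ᵥ u) ^ 2 / n := by
  rcases Nat.eq_zero_or_pos n with rfl | hn
  · simp [skDev]
  have hn' : (1 : ℝ) ≤ n := by exact_mod_cast hn
  have hn0 : (0 : ℝ) < n := by linarith
  have hcov : ∀ i k, gaussForm (skCoef (Pi.single i 1) u) (skCoef (Pi.single k 1) u)
      = ((if i = k then u ⬝ᵥ u - 2 * u i ^ 2 else 0) + u i * u k) / n := by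
    intro i k
    rw [gaussForm_skCoef]
    congr 1
    by_cases h : i = k
    · subst h
      simp [Pi.single_apply]; ring
    · have : ∀ p, (Pi.single i 1 : Fin n → ℝ) p * u p * (Pi.single k 1 : Fin n → ℝ) p * u p = 0 := by
        intro p
        by_cases hp : p = i
        · subst hp; simp [h]
        · simp [hp]
      simp [this, h]
  have key := integral_sum_gaussForm_sq_sub (fun i => skCoef (Pi.single i 1) u)
  have e : (fun ω => (∑ k, gaussForm (skCoef (Pi.single k 1) u) ω ^ 2
      - ∑ k, gaussForm (skCoef (Pi.single k 1) u) (skCoef (Pi.single k 1) u)) ^ 2)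
      = fun ω => skDev ω u ^ 2 := by
    ext ω
    congr 1
    rw [skDev]
    congr 1
    · simp_rw [← dotProduct_skA_mulVec, single_one_dotProduct, sq]
      rfl
    · simp_rw [hcov]
      rw [← Finset.sum_div, div_mul_eq_mul_div]
      congr 1
      simp only [if_true]
      have : ∀ i, u ⬝ᵥ u - 2 * u i ^ 2 + u i * u i = u ⬝ᵥ u - u i * u i := fun i => by ring
      simp_rw [this, Finset.sum_sub_distrib]
      simp [dotProduct]; ring
  rw [e] at key
  refine ⟨key.1, key.2.le.trans ?_⟩
  simp_rw [hcov]
  have hb : ∀ i k, (((if i = k then u ⬝ᵥ u - 2 * u i ^ 2 else 0) + u i * u k) / n) ^ 2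
      ≤ ((if i = k then 2 * (u ⬝ᵥ u) ^ 2 else 0) + 2 * ((u i * u i) * (u k * u k))) / n ^ 2 := by
    intro i k
    rw [div_pow]
    gcongr
    have h1 := sq_le_dotProduct_self u i
    split_ifs with h
    · nlinarith [sq_nonneg (u ⬝ᵥ u - 2 * u i ^ 2 - u i * u k), sq_nonneg (u i)]
    · nlinarith [sq_nonneg (u i * u k)]
  calc 2 * ∑ i, ∑ k, (((if i = k then u ⬝ᵥ u - 2 * u i ^ 2 else 0) + u i * u k) / n) ^ 2
      ≤ 2 * ∑ i, ∑ k, ((if i = k then 2 * (u ⬝ᵥ u) ^ 2 else 0)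
          + 2 * ((u i * u i) * (u k * u k))) / (n : ℝ) ^ 2 := by gcongr with i _ k _; exact hb i k
    _ = 2 * ((n * (2 * (u ⬝ᵥ u) ^ 2) + 2 * ((u ⬝ᵥ u) * (u ⬝ᵥ u))) / n ^ 2) := by
        simp_rw [← Finset.sum_div, Finset.sum_add_distrib, ← Finset.mul_sum]
        rw [← Finset.sum_mul]
        simp [dotProduct]
    _ ≤ 8 * (u ⬝ᵥ u) ^ 2 / n := by
        rw [← mul_div_assoc, div_le_div_iff₀ (by positivity) hn0]
        have : 0 ≤ (u ⬝ᵥ u) ^ 2 * n * (n - 1) := by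
          have : 0 ≤ (n : ℝ) - 1 := by linarith
          positivity
        nlinarith

/-- The deviation of `A x ⬝ᵥ A y` from its mean. -/
def skCross {n : ℕ} (ω : Fin n → Fin n → ℝ) (x y : Fin n → ℝ) : ℝ :=
  (skA n ω).mulVec x ⬝ᵥ (skA n ω).mulVec y - ((n : ℝ) - 1) / n * (x ⬝ᵥ y)

theorem skCross_eq {n : ℕ} (ω : Fin n → Fin n → ℝ) (x y : Fin n → ℝ) :
    skCross ω x y = (skDev ω (x + y) - skDev ω (x - y)) / 4 := by
  simp only [skCross, skDev, mulVec_add, mulVec_sub, add_dotProduct, dotProduct_add,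
    sub_dotProduct, dotProduct_sub]
  rw [dotProduct_comm ((skA n ω).mulVec y) ((skA n ω).mulVec x), dotProduct_comm y x]
  ring

theorem measurable_skA_apply {n : ℕ} (i j : Fin n) : Measurable fun ω => skA n ω i j := by
  unfold skA
  simp only [of_apply]
  split_ifs <;> fun_prop

theorem measurable_skCross {α : Type*} [MeasurableSpace α] {n : ℕ}
    {f : α → Fin n → Fin n → ℝ} {g h : α → Fin n → ℝ} (hf : Measurable f) (hg : Measurable g)
    (hh : Measurable h) : Measurable fun a => skCross (f a) (g a) (h a) := by
  have hA : ∀ i j, Measurable fun a => skA n (f a) i j :=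
    fun i j => (measurable_skA_apply i j).comp hf
  unfold skCross dotProduct mulVec dotProduct
  fun_prop

theorem dotProduct_self_add_sq_add_sub_sq_le {ι : Type*} [Fintype ι] (x y : ι → ℝ) :
    ((x + y) ⬝ᵥ (x + y)) ^ 2 + ((x - y) ⬝ᵥ (x - y)) ^ 2 ≤ 4 * (x ⬝ᵥ x + y ⬝ᵥ y) ^ 2 := by
  have h3 : 0 ≤ (x - y) ⬝ᵥ (x - y) := Finset.sum_nonneg fun _ _ => mul_self_nonneg _
  have h4 : 0 ≤ (x + y) ⬝ᵥ (x + y) := Finset.sum_nonneg fun _ _ => mul_self_nonneg _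
  simp only [add_dotProduct, dotProduct_add, sub_dotProduct, dotProduct_sub] at h3 h4 ⊢
  rw [dotProduct_comm y x] at *
  generalize x ⬝ᵥ x = a at *
  generalize y ⬝ᵥ y = b at *
  generalize x ⬝ᵥ y = c at *
  nlinarith [mul_nonneg h3 h4]

theorem integral_skCross_sq_le {n : ℕ} (x y : Fin n → ℝ) :
    Integrable (fun ω => skCross ω x y ^ 2) (gaussArray n) ∧
      ∫ ω, skCross ω x y ^ 2 ∂(gaussArray n) ≤ 4 * (x ⬝ᵥ x + y ⬝ᵥ y) ^ 2 / n := by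
  obtain ⟨ia, ha⟩ := integral_skDev_sq_le (x + y)
  obtain ⟨ib, hb⟩ := integral_skDev_sq_le (x - y)
  have hle : ∀ ω, skCross ω x y ^ 2 ≤ (skDev ω (x + y) ^ 2 + skDev ω (x - y) ^ 2) / 8 := fun ω => by
    rw [skCross_eq]
    generalize skDev ω (x + y) = a
    generalize skDev ω (x - y) = b
    nlinarith [sq_nonneg (a + b)]
  have hi : Integrable (fun ω => (skDev ω (x + y) ^ 2 + skDev ω (x - y) ^ 2) / 8) (gaussArray n) :=
    (ia.fun_add ib).div_const 8
  have hm : Measurable fun ω => skCross ω x y :=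
    measurable_skCross measurable_id measurable_const measurable_const
  have hint : Integrable (fun ω => skCross ω x y ^ 2) (gaussArray n) :=
    hi.mono' (hm.pow_const 2).aestronglyMeasurable (Filter.Eventually.of_forall fun ω => by
      rw [Real.norm_of_nonneg (sq_nonneg _)]; exact hle ω)
  have hI := integral_mono hint hi hle
  rw [integral_div, integral_add ia ib] at hI
  have h2 := div_le_div_of_nonneg_right (dotProduct_self_add_sq_add_sub_sq_le x y)
    (Nat.cast_nonneg (α := ℝ) n)
  have h3 : ∫ ω, skCross ω x y ^ 2 ∂(gaussArray n) ≤
      (((x + y) ⬝ᵥ (x + y)) ^ 2 + ((x - y) ⬝ᵥ (x - y)) ^ 2) / n := by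
    refine hI.trans ?_
    rw [div_le_iff₀ (by norm_num)]
    refine (add_le_add ha hb).trans (le_of_eq ?_)
    ring
  exact ⟨hint, h3.trans h2⟩

theorem integral_dotProduct_skA_mulVec_sq_le {n : ℕ} (y x : Fin n → ℝ) :
    Integrable (fun ω => (y ⬝ᵥ (skA n ω).mulVec x) ^ 2) (gaussArray n) ∧
      ∫ ω, (y ⬝ᵥ (skA n ω).mulVec x) ^ 2 ∂(gaussArray n) ≤ 2 * ((y ⬝ᵥ y) * (x ⬝ᵥ x)) / n := by
  simp_rw [dotProduct_skA_mulVec]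
  exact ⟨integrable_gaussForm_pow _ 2,
    (integral_gaussForm_sq _).le.trans (gaussForm_skCoef_self_le y x)⟩

theorem exists_finset_half_net (E : Type*) [NormedAddCommGroup E] [NormedSpace ℝ E]
    [FiniteDimensional ℝ E] : ∃ s : Finset E, s.card ≤ 5 ^ Module.finrank ℝ E ∧
      (∀ c ∈ s, ‖c‖ ≤ 1) ∧ ∀ x : E, ‖x‖ ≤ 1 → ∃ c ∈ s, ‖x - c‖ ≤ 1 / 2 := by
  classical
  let P : ℕ → Prop := fun k => ∃ s : Finset E, s.card = k ∧ (∀ c ∈ s, ‖c‖ ≤ 1) ∧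
    ∀ c ∈ s, ∀ d ∈ s, c ≠ d → 1 / 2 ≤ ‖c - d‖
  have hP : ∀ k, P k → k ≤ 5 ^ Module.finrank ℝ E := by
    rintro k ⟨s, rfl, hs, hsep⟩
    have hinj : Function.Injective fun c : E => (2 : ℝ) • c := smul_right_injective E two_ne_zero
    rw [← Finset.card_image_of_injective s hinj]
    apply Besicovitch.card_le_of_separated
    · intro c hc
      obtain ⟨a, ha, rfl⟩ := Finset.mem_image.1 hc
      have := hs a ha
      simp only [norm_smul, Real.norm_ofNat]; linarith
    · intro c hc d hd hcd
      obtain ⟨a, ha, rfl⟩ := Finset.mem_image.1 hc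
      obtain ⟨b, hb, rfl⟩ := Finset.mem_image.1 hd
      have := hsep a ha b hb (fun h => hcd (by rw [h]))
      simp only [← smul_sub, norm_smul, Real.norm_ofNat]; linarith
  obtain ⟨s, hcard, hs, hsep⟩ : P (Nat.findGreatest P (5 ^ Module.finrank ℝ E)) :=
    Nat.findGreatest_spec (Nat.zero_le _) ⟨∅, by simp⟩
  refine ⟨s, hcard ▸ Nat.findGreatest_le _, hs, fun x hx => ?_⟩
  by_contra! hcon
  have hxs : x ∉ s := fun h => by
    have := hcon x h
    simp at this
    linarith
  have hPs : P (s.card + 1) := by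
    refine ⟨insert x s, Finset.card_insert_of_notMem hxs, ?_, ?_⟩
    · intro c hc
      rcases Finset.mem_insert.1 hc with rfl | hc
      exacts [hx, hs c hc]
    · intro c hc d hd hcd
      rcases Finset.mem_insert.1 hc with hcx | hcs <;> rcases Finset.mem_insert.1 hd with hdx | hds
      · exact absurd (hcx.trans hdx.symm) hcd
      · rw [hcx]; exact (hcon d hds).le
      · rw [hdx, norm_sub_rev]; exact (hcon c hcs).le
      · exact hsep c hcs d hds hcd
  have := Nat.le_findGreatest (hP _ hPs) hPs
  omega

open scoped RealInnerProductSpace in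
theorem opNorm_le_of_half_net {E : Type*} [NormedAddCommGroup E] [InnerProductSpace ℝ E]
    (s : Finset E) (hnet : ∀ x : E, ‖x‖ ≤ 1 → ∃ c ∈ s, ‖x - c‖ ≤ 1 / 2) (T : E →L[ℝ] E) {t : ℝ}
    (ht : 0 ≤ t) (h : ∀ x ∈ s, ∀ y ∈ s, ⟪y, T x⟫ ≤ t) : ‖T‖ ≤ 4 * t := by
  have hnorm : ∀ x ∈ s, ‖T x‖ ≤ 2 * t := by
    intro x hx
    by_cases hz : T x = 0
    · rw [hz, norm_zero]; positivity
    have hz' : 0 < ‖T x‖ := norm_pos_iff.2 hz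
    obtain ⟨y, hy, hxy⟩ := hnet (‖T x‖⁻¹ • T x) (by rw [norm_smul]; simp [hz'.ne'])
    have h1 : ⟪‖T x‖⁻¹ • T x, T x⟫ = ‖T x‖ := by
      rw [real_inner_smul_left, real_inner_self_eq_norm_sq]; field_simp
    have h2 : ⟪‖T x‖⁻¹ • T x, T x⟫ = ⟪y, T x⟫ + ⟪‖T x‖⁻¹ • T x - y, T x⟫ := by
      rw [inner_sub_left]; ring
    have h3 := real_inner_le_norm (‖T x‖⁻¹ • T x - y) (T x)
    have h4 := h x hx y hy
    nlinarith
  have hle : ‖T‖ ≤ 2 * t + ‖T‖ / 2 := by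
    refine T.opNorm_le_of_unit_norm (by positivity) fun x hx => ?_
    obtain ⟨c, hc, hxc⟩ := hnet x hx.le
    have h1 : T x = T c + T (x - c) := by simp
    have h2 := T.le_opNorm (x - c)
    have h3 := norm_add_le (T c) (T (x - c))
    have h4 := hnorm c hc
    rw [h1]
    nlinarith [norm_nonneg T]
  linarith

theorem measureReal_le_gaussForm_le {n : ℕ} (c : Fin n → Fin n → ℝ) {s t : ℝ} (hs : 0 ≤ s)
    (hc : gaussForm c c ≤ s) (ht : 0 ≤ t) :
    (gaussArray n).real {ω | t ≤ gaussForm c ω} ≤ Real.exp (-t ^ 2 / (2 * s)) := by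
  have h : HasSubgaussianMGF (gaussForm c) s.toNNReal (gaussArray n) := by
    have hmgf := mgf_gaussianReal (hasLaw_gaussForm c).map_eq
    refine ⟨fun r => ?_, fun r => ?_⟩
    · have := (integrable_exp_mul_gaussianReal (μ := 0) (v := (gaussForm c c).toNNReal) r)
      rw [← (hasLaw_gaussForm c).map_eq] at this
      exact this.comp_aemeasurable (hasLaw_gaussForm c).aemeasurable
    · rw [hmgf, Real.coe_toNNReal _ hs, Real.coe_toNNReal _ (gaussForm_self_nonneg c)]
      gcongr
      nlinarith [sq_nonneg r]
  simpa [Real.coe_toNNReal _ hs] using h.measure_ge_le ht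

theorem inner_toEuclideanCLM {n : ℕ} (M : Matrix (Fin n) (Fin n) ℝ) (x y : EuclideanSpace ℝ (Fin n)) :
    inner ℝ y (Matrix.toEuclideanCLM (𝕜 := ℝ) (n := Fin n) M x)
      = y.ofLp ⬝ᵥ M.mulVec x.ofLp := by
  rw [EuclideanSpace.inner_eq_star_dotProduct]
  simp [dotProduct_comm]

theorem dotProduct_ofLp_self {n : ℕ} (x : EuclideanSpace ℝ (Fin n)) :
    x.ofLp ⬝ᵥ x.ofLp = ‖x‖ ^ 2 := by
  rw [EuclideanSpace.real_norm_sq_eq]; simp [dotProduct, sq]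

theorem measureReal_specNorm_skA_gt_le {n : ℕ} (hn : 0 < n) :
    (gaussArray n).real {ω | 32 < specNorm (skA n ω)} ≤ (1 / 2) ^ n := by
  obtain ⟨s, hcard, hs, hnet⟩ := exists_finset_half_net (EuclideanSpace ℝ (Fin n))
  rw [finrank_euclideanSpace_fin] at hcard
  have hn' : (0 : ℝ) < n := by exact_mod_cast hn
  have hsub : {ω | 32 < specNorm (skA n ω)} ⊆
      ⋃ p ∈ s ×ˢ s, {ω | 8 ≤ gaussForm (skCoef p.2.ofLp p.1.ofLp) ω} := by
    intro ω hω
    by_contra hcon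
    simp only [Set.mem_iUnion, Set.mem_ofPred_eq, not_exists, not_le] at hcon
    have := opNorm_le_of_half_net s hnet (Matrix.toEuclideanCLM (𝕜 := ℝ) (n := Fin n) (skA n ω))
      (t := 8) (by norm_num) fun x hx y hy => by
        rw [inner_toEuclideanCLM, dotProduct_skA_mulVec]
        exact (hcon (x, y) (Finset.mk_mem_product hx hy)).le
    have hω' : 32 < ‖Matrix.toEuclideanCLM (𝕜 := ℝ) (n := Fin n) (skA n ω)‖ := hω
    linarith
  have htail : ∀ p ∈ s ×ˢ s, (gaussArray n).real {ω | 8 ≤ gaussForm (skCoef p.2.ofLp p.1.ofLp) ω}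
      ≤ Real.exp (-16) ^ n := by
    intro p hp
    obtain ⟨h1, h2⟩ := Finset.mem_product.1 hp
    have hc : gaussForm (skCoef p.2.ofLp p.1.ofLp) (skCoef p.2.ofLp p.1.ofLp) ≤ 2 / n := by
      refine (gaussForm_skCoef_self_le _ _).trans ?_
      gcongr
      rw [dotProduct_ofLp_self, dotProduct_ofLp_self]
      have := mul_le_one₀ (pow_le_one₀ (n := 2) (norm_nonneg _) (hs _ h2)) (sq_nonneg _)
        (pow_le_one₀ (n := 2) (norm_nonneg _) (hs _ h1))
      linarith
    refine (measureReal_le_gaussForm_le _ (by positivity) hc (by norm_num)).trans (le_of_eq ?_)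
    rw [← Real.exp_nat_mul]
    congr 1
    field_simp
    norm_num
  have hexp : 25 * Real.exp (-16) ≤ 1 / 2 := by
    have h1 : (5 : ℝ) ≤ Real.exp 4 := by linarith [Real.add_one_le_exp (4 : ℝ)]
    have h2 : Real.exp 16 = Real.exp 4 ^ 4 := by rw [← Real.exp_nat_mul]; norm_num
    have h3 : (5 : ℝ) ^ 4 ≤ Real.exp 16 := by rw [h2]; gcongr
    rw [Real.exp_neg, ← div_eq_mul_inv, div_le_div_iff₀ (Real.exp_pos _) (by norm_num)]
    linarith
  calc (gaussArray n).real {ω | 32 < specNorm (skA n ω)}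
      ≤ ∑ p ∈ s ×ˢ s, (gaussArray n).real {ω | 8 ≤ gaussForm (skCoef p.2.ofLp p.1.ofLp) ω} :=
        (measureReal_mono hsub (measure_ne_top _ _)).trans (measureReal_biUnion_finset_le _ _)
    _ ≤ ((s ×ˢ s).card : ℝ) * Real.exp (-16) ^ n := by
        rw [← nsmul_eq_mul]; exact Finset.sum_le_card_nsmul _ _ _ htail
    _ ≤ 25 ^ n * Real.exp (-16) ^ n := by
        gcongr
        rw [Finset.card_product]
        have : s.card * s.card ≤ 5 ^ n * 5 ^ n := Nat.mul_le_mul hcard hcard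
        rw [← mul_pow] at this
        exact_mod_cast this
    _ ≤ (1 / 2) ^ n := by
        rw [← mul_pow]; gcongr

theorem measureReal_frobenius_skA_lt_le {n : ℕ} (hn : 4 ≤ n) :
    (gaussArray n).real {ω | ∑ i, ∑ j, skA n ω i j ^ 2 < 1 / 2 * n} ≤ 128 / n := by
  have hn' : (4 : ℝ) ≤ n := by exact_mod_cast hn
  have hn0 : (n : ℝ) ≠ 0 := by linarith
  have hsum : ∀ ω, ∑ i, ∑ j, skA n ω i j ^ 2 = ∑ j, skDev ω (Pi.single j 1) + (n - 1) := by
    intro ω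
    simp only [skDev, mulVec_single_one, dotProduct_single_one, Pi.single_eq_same, mul_one,
      Finset.sum_sub_distrib]
    rw [Finset.sum_comm]
    simp [dotProduct, sq]
    field_simp
    ring
  have hi : ∀ j : Fin n, Integrable (fun ω => skDev ω (Pi.single j 1) ^ 2) (gaussArray n) :=
    fun j => (integral_skDev_sq_le _).1
  have hle : ∀ ω, (∑ j : Fin n, skDev ω (Pi.single j 1)) ^ 2 ≤ n * ∑ j, skDev ω (Pi.single j 1) ^ 2 :=
    fun ω => sq_sum_le_card_mul_sum_sq.trans_eq (by simp)
  have hbound : ∫ ω, n * ∑ j, skDev ω (Pi.single j 1) ^ 2 ∂(gaussArray n) ≤ 8 * n := by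
    rw [integral_const_mul, integral_finsetSum _ fun j _ => hi j]
    have : ∑ j : Fin n, ∫ ω, skDev ω (Pi.single j 1) ^ 2 ∂(gaussArray n) ≤ ∑ _j : Fin n, 8 / (n : ℝ) :=
      Finset.sum_le_sum fun j _ => by simpa using (integral_skDev_sq_le (Pi.single j (1 : ℝ))).2
    have h2 : ∑ _j : Fin n, 8 / (n : ℝ) = 8 := by simp; field_simp
    rw [mul_comm 8]
    gcongr
    linarith
  have hmeas : Measurable fun ω => ∑ j : Fin n, skDev ω (Pi.single j 1) := by
    have hA := measurable_skA_apply (n := n)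
    unfold skDev dotProduct mulVec dotProduct
    fun_prop
  have hint := (integrable_finsetSum Finset.univ fun j _ => hi j).const_mul (n : ℝ)
  have hint2 : Integrable (fun ω => (∑ j, skDev ω (Pi.single j 1)) ^ 2) (gaussArray n) :=
    hint.mono' (hmeas.pow_const 2).aestronglyMeasurable (Filter.Eventually.of_forall fun ω => by
      rw [Real.norm_of_nonneg (sq_nonneg _)]; exact hle ω)
  have key := measureReal_abs_ge_le_of_integral_sq_le hint2 (t := n / 4) (by positivity)
    ((integral_mono hint2 hint hle).trans hbound)
  refine (measureReal_mono ?_).trans (key.trans (le_of_eq ?_))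
  · intro ω hω
    have h1 : ∑ i, ∑ j, skA n ω i j ^ 2 < 1 / 2 * n := hω
    rw [hsum] at h1
    have : (n : ℝ) / 4 ≤ |∑ j, skDev ω (Pi.single j 1)| :=
      le_trans (by linarith) (neg_le_abs _)
    exact this
  · field_simp; norm_num

theorem ofReal_one_sub_le_measure {Ω : Type*} [MeasurableSpace Ω] {μ : Measure Ω}
    [IsProbabilityMeasure μ] {s : Set Ω} {ε : ℝ} (h : μ.real sᶜ ≤ ε) :
    ENNReal.ofReal (1 - ε) ≤ μ s := by
  have h1 := measureReal_union_le (μ := μ) s sᶜ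
  rw [Set.union_compl_self, probReal_univ] at h1
  rw [← ofReal_measureReal]
  exact ENNReal.ofReal_le_ofReal (by linarith)

theorem exists_forall_ofReal_one_sub_le_gaussArray {ε : ℝ} (hε : 0 < ε) :
    ∃ N : ℕ, ∀ n : ℕ, N ≤ n →
      ENNReal.ofReal (1 - ε) ≤ gaussArray n {ω | specNorm (skA n ω) ≤ 32
        ∧ 1 / 2 * n ≤ ∑ i, ∑ j, (skA n ω i j) ^ 2} := by
  have h1 : Filter.Tendsto (fun n : ℕ => (1 / 2 : ℝ) ^ n + 128 / n) Filter.atTop (nhds (0 + 0)) :=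
    (tendsto_pow_atTop_nhds_zero_of_lt_one (by norm_num) (by norm_num)).add
      (tendsto_const_div_atTop_nhds_zero_nat 128)
  rw [add_zero] at h1
  obtain ⟨N, hN⟩ := Filter.eventually_atTop.1 (h1.eventually (gt_mem_nhds hε))
  refine ⟨max N 4, fun n hn => ofReal_one_sub_le_measure ?_⟩
  have hn4 : 4 ≤ n := (le_max_right _ _).trans hn
  have hsub : {ω | specNorm (skA n ω) ≤ 32 ∧ 1 / 2 * n ≤ ∑ i, ∑ j, (skA n ω i j) ^ 2}ᶜ ⊆
      {ω | 32 < specNorm (skA n ω)} ∪ {ω | ∑ i, ∑ j, skA n ω i j ^ 2 < 1 / 2 * n} := by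
    intro ω hω
    by_contra hcon
    simp only [Set.mem_union, Set.mem_ofPred_eq, not_or, not_lt] at hcon
    exact hω hcon
  refine (measureReal_mono hsub (measure_ne_top _ _)).trans
    ((measureReal_union_le _ _).trans ?_)
  linarith [hN n ((le_max_left _ _).trans hn), measureReal_specNorm_skA_gt_le (n := n) (by omega),
    measureReal_frobenius_skA_lt_le hn4]

theorem infinitePi_map_comp_of_injective {ι κ E : Type*} [Fintype κ] [MeasurableSpace E]
    (ν : Measure E) [IsProbabilityMeasure ν] {e : κ → ι} (he : Function.Injective e) :
    (Measure.infinitePi fun _ : ι => ν).map (fun ω k => ω (e k)) = Measure.pi fun _ : κ => ν := by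
  have h : iIndepFun (fun (i : ι) (ω : ι → E) => ω i) (Measure.infinitePi fun _ : ι => ν) :=
    iIndepFun_infinitePi (X := fun _ x => x) fun _ => measurable_id
  have h2 := (iIndepFun_iff_map_fun_eq_pi_map fun k => (measurable_pi_apply (e k)).aemeasurable).1 (h.precomp he)
  refine h2.trans ?_
  congr 1
  ext1 k
  exact Measure.infinitePi_map_eval _ (e k)

theorem tendsto_measureReal_abs_average_sub_ge {E : Type*} [MeasurableSpace E] (ν : Measure E)
    [IsProbabilityMeasure ν] {f : E → ℝ} (hf : Measurable f) (hfi : Integrable f ν) {η : ℝ}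
    (hη : 0 < η) :
    Filter.Tendsto (fun n : ℕ => (Measure.pi fun _ : Fin n => ν).real
      {X | η ≤ |(∑ i, f (X i)) / n - ∫ x, f x ∂ν|}) Filter.atTop (nhds 0) := by
  set P := Measure.infinitePi fun _ : ℕ => ν with hP
  have hmap : ∀ i, P.map (fun ω => ω i) = ν := Measure.infinitePi_map_eval _
  have hfm : ∀ i, Measurable fun ω : ℕ → E => f (ω i) := fun i => hf.comp (measurable_pi_apply i)
  have hind : iIndepFun (fun (i : ℕ) (ω : ℕ → E) => f (ω i)) P :=
    iIndepFun_infinitePi (X := fun _ => f) fun _ => hf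
  have hslln := strong_law_ae_real (μ := P) (fun i ω => f (ω i))
    (((measurePreserving_eval_infinitePi (fun _ : ℕ => ν) 0).integrable_comp_of_integrable hfi))
    (fun i j hij => hind.indepFun hij)
    fun i => ⟨(hfm i).aemeasurable, (hfm 0).aemeasurable, by
      rw [← Function.comp_def f, ← Function.comp_def f, ← Measure.map_map hf (by fun_prop),
        ← Measure.map_map hf (by fun_prop), hmap, hmap]⟩
  have hint : ∫ ω, f (ω 0) ∂P = ∫ x, f x ∂ν := by
    rw [← hmap 0, integral_map (measurable_pi_apply 0).aemeasurable (by rw [hmap]; exact hf.aestronglyMeasurable)]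
  rw [hint] at hslln
  have hm := tendstoInMeasure_of_tendsto_ae (fun n => Measurable.aestronglyMeasurable (by fun_prop)) hslln
  have hm' := (tendstoInMeasure_iff_measureReal_norm.1 hm) η hη
  refine hm'.congr fun n => ?_
  rw [← infinitePi_map_comp_of_injective ν (Fin.val_injective (n := n)),
    map_measureReal_apply (by fun_prop) (measurableSet_le (by fun_prop) (by fun_prop))]
  congr 1
  ext ω
  simp [Finset.sum_range]

theorem measurable_dotProduct_skA_mulVec {α : Type*} [MeasurableSpace α] {n : ℕ}
    {f : α → Fin n → Fin n → ℝ} {g h : α → Fin n → ℝ} (hf : Measurable f) (hg : Measurable g)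
    (hh : Measurable h) : Measurable fun a => g a ⬝ᵥ (skA n (f a)).mulVec (h a) := by
  have hA : ∀ i j, Measurable fun a => skA n (f a) i j :=
    fun i j => (measurable_skA_apply i j).comp hf
  unfold dotProduct mulVec dotProduct
  fun_prop

/-- The event that some entry of the fluctuation of `XᵀAᵀAX`, or of `XᵀAX`, is at least `ηn`. -/
def skFluct (n d : ℕ) (η : ℝ) : Set ((Fin n → Fin n → ℝ) × (Fin n → Fin d → ℝ)) :=
  ⋃ k, ⋃ l, ({p | η * n ≤ |skCross p.1 (fun i => p.2 i k) (fun i => p.2 i l)|} ∪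
    {p | η * n ≤ |(fun i => p.2 i k) ⬝ᵥ (skA n p.1).mulVec fun i => p.2 i l|})

theorem measurableSet_skFluct (n d : ℕ) (η : ℝ) : MeasurableSet (skFluct n d η) := by
  have hcol : ∀ k : Fin d, Measurable fun (p : (Fin n → Fin n → ℝ) × (Fin n → Fin d → ℝ)) i =>
    p.2 i k := fun k => by fun_prop
  refine .iUnion fun k => .iUnion fun l => .union ?_ ?_
  · exact measurableSet_le measurable_const
      (measurable_skCross measurable_fst (hcol k) (hcol l)).abs
  · exact measurableSet_le measurable_const
      (measurable_dotProduct_skA_mulVec measurable_fst (hcol k) (hcol l)).abs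

theorem measureReal_skFluct_section_le {n d : ℕ} (hn : 0 < n) {η K : ℝ} (hη : 0 < η)
    (X : Fin n → Fin d → ℝ) (hX : ∀ k, (fun i => X i k) ⬝ᵥ (fun i => X i k) ≤ K * n) :
    (gaussArray n).real {ω | (ω, X) ∈ skFluct n d η} ≤ d * (d * (18 * K ^ 2 / η ^ 2 / n)) := by
  have hn' : (0 : ℝ) < n := by exact_mod_cast hn
  have hnn : ∀ k, 0 ≤ (fun i => X i k) ⬝ᵥ (fun i => X i k) :=
    fun k => Finset.sum_nonneg fun _ _ => mul_self_nonneg _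
  have e : {ω | (ω, X) ∈ skFluct n d η} =
      ⋃ k, ⋃ l, ({ω | η * n ≤ |skCross ω (fun i => X i k) (fun i => X i l)|} ∪
        {ω | η * n ≤ |(fun i => X i k) ⬝ᵥ (skA n ω).mulVec fun i => X i l|}) := by
    ext ω; simp [skFluct]
  have hkl : ∀ k l, (gaussArray n).real
      ({ω | η * n ≤ |skCross ω (fun i => X i k) (fun i => X i l)|} ∪
        {ω | η * n ≤ |(fun i => X i k) ⬝ᵥ (skA n ω).mulVec fun i => X i l|})
      ≤ 18 * K ^ 2 / η ^ 2 / n := by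
    intro k l
    obtain ⟨i1, h1⟩ := integral_skCross_sq_le (fun i => X i k) (fun i => X i l)
    obtain ⟨i2, h2⟩ := integral_dotProduct_skA_mulVec_sq_le (fun i => X i k) (fun i => X i l)
    have b1 := measureReal_abs_ge_le_of_integral_sq_le i1 (mul_pos hη hn') h1
    have b2 := measureReal_abs_ge_le_of_integral_sq_le i2 (mul_pos hη hn') h2
    have c1 : 4 * ((fun i => X i k) ⬝ᵥ (fun i => X i k) + (fun i => X i l) ⬝ᵥ (fun i => X i l)) ^ 2
        / n / (η * n) ^ 2 ≤ 4 * (K * n + K * n) ^ 2 / n / (η * n) ^ 2 := by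
      have := hnn k; have := hnn l; gcongr <;> exact hX _
    have c2 : 2 * (((fun i => X i k) ⬝ᵥ (fun i => X i k)) * ((fun i => X i l) ⬝ᵥ (fun i => X i l)))
        / n / (η * n) ^ 2 ≤ 2 * ((K * n) * (K * n)) / n / (η * n) ^ 2 := by
      have hk := hnn k; have hl := hnn l
      have := hk.trans (hX k)
      gcongr <;> exact hX _
    calc _ ≤ _ := measureReal_union_le _ _
      _ ≤ 4 * (K * n + K * n) ^ 2 / n / (η * n) ^ 2 + 2 * ((K * n) * (K * n)) / n / (η * n) ^ 2 :=
        add_le_add (b1.trans c1) (b2.trans c2)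
      _ = 18 * K ^ 2 / η ^ 2 / n := by field_simp; ring
  rw [e]
  have hsum : ∀ {s : Fin d → Set (Fin n → Fin n → ℝ)} {B : ℝ},
      (∀ k, (gaussArray n).real (s k) ≤ B) → (gaussArray n).real (⋃ k, s k) ≤ d * B := by
    intro s B h
    refine (measureReal_iUnion_fintype_le _).trans ((Finset.sum_le_sum fun k _ => h k).trans ?_)
    simp
  exact hsum fun k => hsum fun l => hkl k l

theorem measureReal_prod_le_of_section_le {α β : Type*} [MeasurableSpace α] [MeasurableSpace β]
    {μ : Measure α} {ν : Measure β} [IsProbabilityMeasure μ] [IsProbabilityMeasure ν]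
    {B : Set (α × β)} (hB : MeasurableSet B) {G : Set β} (hG : MeasurableSet G) {ε : ℝ}
    (hε : 0 ≤ ε) (h : ∀ y ∈ G, μ.real {x | (x, y) ∈ B} ≤ ε) :
    (μ.prod ν).real (B ∪ Prod.snd ⁻¹' Gᶜ) ≤ ε + ν.real Gᶜ := by
  have h1 : (μ.prod ν).real (B ∩ Prod.snd ⁻¹' G) ≤ ε := by
    rw [measureReal_def, Measure.prod_apply_symm (hB.inter (measurable_snd hG))]
    refine ENNReal.toReal_le_of_le_ofReal hε ?_
    calc _ ≤ ∫⁻ _y, ENNReal.ofReal ε ∂ν := by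
          refine lintegral_mono fun y => ?_
          by_cases hy : y ∈ G
          · refine (measure_mono fun x hx => ?_).trans
              ((ENNReal.le_ofReal_iff_toReal_le (measure_ne_top _ _) hε).2 (h y hy))
            exact hx.1
          · have : (fun x => (x, y)) ⁻¹' (B ∩ Prod.snd ⁻¹' G) = ∅ := by
              ext x; simp [hy]
            simp [this]
      _ = ENNReal.ofReal ε := by simp
  have h2 : (μ.prod ν).real (Prod.snd ⁻¹' Gᶜ) = ν.real Gᶜ := by
    rw [measureReal_def, measureReal_def, ← Measure.snd_apply hG.compl, Measure.snd_prod]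
  have hsub : B ∪ Prod.snd ⁻¹' Gᶜ ⊆ (B ∩ Prod.snd ⁻¹' G) ∪ Prod.snd ⁻¹' Gᶜ := by
    intro p hp
    by_cases hpG : p.2 ∈ G
    · rcases hp with hp | hp
      exacts [Or.inl ⟨hp, hpG⟩, absurd hpG hp]
    · exact Or.inr hpG
  refine (measureReal_mono hsub (measure_ne_top _ _)).trans ((measureReal_union_le _ _).trans ?_)
  rw [h2]
  gcongr

theorem dotProduct_mulVec_self_le {m : Type*} [Fintype m] {E : Matrix m m ℝ} {η : ℝ}
    (hE : ∀ k l, |E k l| ≤ η) (v : m → ℝ) :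
    E.mulVec v ⬝ᵥ E.mulVec v ≤ (Fintype.card m * η) ^ 2 * (v ⬝ᵥ v) := by
  have hrow : ∀ k, E.mulVec v k * E.mulVec v k ≤ Fintype.card m * η ^ 2 * (v ⬝ᵥ v) := by
    intro k
    have h1 := dotProduct_sq_le (E k) v
    have h2 : E k ⬝ᵥ E k ≤ Fintype.card m * η ^ 2 := by
      refine (Finset.sum_le_sum fun l _ => ?_).trans
        (b := ∑ _l : m, η ^ 2) (by simp)
      rw [← sq, ← sq_abs]
      have := hE k l
      gcongr
    have h3 : 0 ≤ v ⬝ᵥ v := Finset.sum_nonneg fun _ _ => mul_self_nonneg _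
    rw [← sq]
    exact h1.trans (by gcongr)
  refine (Finset.sum_le_sum fun k _ => hrow k).trans (le_of_eq ?_)
  simp
  ring

theorem abs_dotProduct_mulVec_le {m : Type*} [Fintype m] {E : Matrix m m ℝ} {η : ℝ} (hη : 0 ≤ η)
    (hE : ∀ k l, |E k l| ≤ η) (v : m → ℝ) :
    |v ⬝ᵥ E.mulVec v| ≤ Fintype.card m * η * (v ⬝ᵥ v) := by
  have h3 : 0 ≤ v ⬝ᵥ v := Finset.sum_nonneg fun _ _ => mul_self_nonneg _
  refine abs_le_of_sq_le_sq ?_ (by positivity)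
  have h1 := dotProduct_sq_le v (E.mulVec v)
  have h2 := dotProduct_mulVec_self_le hE v
  nlinarith

theorem quadratic_form_residual_ge {n d : ℕ} (hn : 0 < n) (X Y : Matrix (Fin n) (Fin d) ℝ)
    (Q : Matrix (Fin d) (Fin d) ℝ) {L η : ℝ} (hL : 0 < L)
    (hQ : ∀ v : Fin d → ℝ, L * (v ⬝ᵥ v) ≤ v ⬝ᵥ Q.mulVec v) (hη : 0 ≤ η) (hηL : d * η ≤ L / 2)
    (hXX : ∀ k l, |((1 / (n : ℝ)) • (Xᵀ * X) - Q) k l| ≤ η)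
    (hYY : ∀ k l, |((1 / (n : ℝ)) • (Yᵀ * Y) - Q) k l| ≤ 3 * η)
    (hXY : ∀ k l, |((1 / (n : ℝ)) • (Xᵀ * Y)) k l| ≤ η) (v : Fin d → ℝ) :
    (L - 4 * (d * η)) * (v ⬝ᵥ v) ≤
      v ⬝ᵥ ((1 / (n : ℝ)) • (Yᵀ * (1 - X * (Xᵀ * X)⁻¹ * Xᵀ) * Y)).mulVec v := by
  have hn' : (0 : ℝ) < n := by exact_mod_cast hn
  have hnn : ∀ w : Fin d → ℝ, 0 ≤ w ⬝ᵥ w :=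
    fun w => Finset.sum_nonneg fun _ _ => mul_self_nonneg _
  set G := (1 / (n : ℝ)) • (Xᵀ * X) with hG
  have hGge : ∀ w : Fin d → ℝ, L / 2 * (w ⬝ᵥ w) ≤ w ⬝ᵥ G.mulVec w := by
    intro w
    have h1 := (abs_le.1 (abs_dotProduct_mulVec_le hη hXX w)).1
    rw [sub_mulVec, dotProduct_sub, Fintype.card_fin] at h1
    nlinarith [hQ w, hnn w]
  have hGunit : IsUnit G := by
    rw [← Matrix.mulVec_injective_iff_isUnit, ← Matrix.coe_mulVecLin]
    refine (injective_iff_map_eq_zero G.mulVecLin).2 fun w hw => ?_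
    have h1 := hGge w
    rw [Matrix.mulVecLin_apply] at hw
    rw [hw, dotProduct_zero] at h1
    exact dotProduct_self_eq_zero.1 (le_antisymm (by nlinarith) (hnn w))
  have hinv : (Xᵀ * X)⁻¹ = (1 / (n : ℝ)) • G⁻¹ := by
    refine Matrix.inv_eq_right_inv ?_
    have : Xᵀ * X = (n : ℝ) • G := by rw [hG, smul_smul]; field_simp; simp
    rw [this, smul_mul_smul_comm, Matrix.mul_nonsing_inv _ ((Matrix.isUnit_iff_isUnit_det _).1 hGunit)]
    field_simp
    simp
  set b := ((1 / (n : ℝ)) • (Xᵀ * Y)).mulVec v with hb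
  set z := G⁻¹.mulVec b with hz
  have hGz : G.mulVec z = b := by
    rw [hz, mulVec_mulVec, Matrix.mul_nonsing_inv _ ((Matrix.isUnit_iff_isUnit_det _).1 hGunit),
      one_mulVec]
  have hexp : v ⬝ᵥ ((1 / (n : ℝ)) • (Yᵀ * (1 - X * (Xᵀ * X)⁻¹ * Xᵀ) * Y)).mulVec v
      = v ⬝ᵥ ((1 / (n : ℝ)) • (Yᵀ * Y)).mulVec v - b ⬝ᵥ z := by
    have e1 : (1 / (n : ℝ)) • (Yᵀ * (1 - X * (Xᵀ * X)⁻¹ * Xᵀ) * Y) = (1 / (n : ℝ)) • (Yᵀ * Y)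
        - ((1 / (n : ℝ)) • (Xᵀ * Y))ᵀ * (G⁻¹ * ((1 / (n : ℝ)) • (Xᵀ * Y))) := by
      rw [hinv]
      simp only [Matrix.mul_sub, Matrix.sub_mul, Matrix.mul_one, smul_sub, Matrix.transpose_smul,
        Matrix.transpose_mul, Matrix.transpose_transpose, Matrix.mul_smul, Matrix.smul_mul,
        Matrix.mul_assoc]
    rw [e1, sub_mulVec, dotProduct_sub, ← mulVec_mulVec, ← mulVec_mulVec, ← hb, ← hz,
      Matrix.dotProduct_mulVec v (_ᵀ), Matrix.vecMul_transpose, ← hb]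
  have hbb : b ⬝ᵥ b ≤ (d * η) ^ 2 * (v ⬝ᵥ v) := by
    have := dotProduct_mulVec_self_le hXY v
    rwa [Fintype.card_fin] at this
  have hzz := hGge z
  rw [hGz, dotProduct_comm z b] at hzz
  have hbz := dotProduct_sq_le b z
  have hYv := (abs_le.1 (abs_dotProduct_mulVec_le (by positivity) hYY v)).1
  rw [sub_mulVec, dotProduct_sub, Fintype.card_fin] at hYv
  rw [hexp]
  have hbz' : b ⬝ᵥ z ≤ d * η * (v ⬝ᵥ v) := by
    have h0 : 0 ≤ b ⬝ᵥ z := le_trans (by have := hnn z; positivity) hzz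
    by_contra! hcon
    have hv := hnn v
    have hd : 0 ≤ d * η := by positivity
    have hpos : 0 < b ⬝ᵥ z := lt_of_le_of_lt (by positivity) hcon
    have h4 : L / 2 * (b ⬝ᵥ z) ^ 2 ≤ (d * η) ^ 2 * (v ⬝ᵥ v) * (b ⬝ᵥ z) :=
      calc L / 2 * (b ⬝ᵥ z) ^ 2 ≤ L / 2 * ((b ⬝ᵥ b) * (z ⬝ᵥ z)) := by gcongr
        _ = (b ⬝ᵥ b) * (L / 2 * (z ⬝ᵥ z)) := by ring
        _ ≤ (d * η) ^ 2 * (v ⬝ᵥ v) * (b ⬝ᵥ z) := by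
          have := hnn b; have := hnn z; gcongr
    have h5 : L / 2 * (b ⬝ᵥ z) ≤ (d * η) ^ 2 * (v ⬝ᵥ v) := by
      refine le_of_mul_le_mul_right ?_ hpos
      linarith
    have h6 : (d * η) ^ 2 * (v ⬝ᵥ v) ≤ L / 2 * (d * η * (v ⬝ᵥ v)) := by
      rw [sq, mul_assoc]; gcongr
    nlinarith
  nlinarith [hQ v, hnn v]

theorem lamMin_mul_le {d : ℕ} {M : Matrix (Fin d) (Fin d) ℝ} (hM : 0 < lamMin M) (v : Fin d → ℝ) :
    lamMin M * (v ⬝ᵥ v) ≤ v ⬝ᵥ M.mulVec v := by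
  have hbdd : BddBelow (Set.range fun v : {v : Fin d → ℝ // ∑ k, (v k) ^ 2 = 1} =>
      v.1 ⬝ᵥ M.mulVec v.1) := by
    by_contra h
    exact hM.ne' (Real.iInf_of_not_bddBelow h)
  by_cases hv : v = 0
  · simp [hv]
  have hpos : 0 < v ⬝ᵥ v := lt_of_le_of_ne
    (Finset.sum_nonneg fun _ _ => mul_self_nonneg _) (Ne.symm (mt dotProduct_self_eq_zero.1 hv))
  have hs : (Real.sqrt (v ⬝ᵥ v))⁻¹ * (Real.sqrt (v ⬝ᵥ v))⁻¹ * (v ⬝ᵥ v) = 1 := by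
    rw [← mul_inv, Real.mul_self_sqrt hpos.le, inv_mul_cancel₀ hpos.ne']
  have hunit : ∑ k, (((Real.sqrt (v ⬝ᵥ v))⁻¹ • v) k) ^ 2 = 1 := by
    have : ∑ k, (((Real.sqrt (v ⬝ᵥ v))⁻¹ • v) k) ^ 2
        = ((Real.sqrt (v ⬝ᵥ v))⁻¹ • v) ⬝ᵥ ((Real.sqrt (v ⬝ᵥ v))⁻¹ • v) := by
      simp only [dotProduct, sq]
    rw [this, smul_dotProduct, dotProduct_smul, smul_eq_mul, smul_eq_mul, ← mul_assoc, hs]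
  have h := ciInf_le hbdd ⟨_, hunit⟩
  simp only [mulVec_smul, smul_dotProduct, dotProduct_smul, smul_eq_mul] at h
  have h' := mul_le_mul_of_nonneg_right h hpos.le
  have e : (Real.sqrt (v ⬝ᵥ v))⁻¹ * ((Real.sqrt (v ⬝ᵥ v))⁻¹ * v ⬝ᵥ M.mulVec v) * (v ⬝ᵥ v)
      = v ⬝ᵥ M.mulVec v := by
    linear_combination (v ⬝ᵥ M.mulVec v) * hs
  rwa [e] at h'

theorem integrable_mul_of_lamMin_pos {d : ℕ} {ν : Measure (Fin d → ℝ)}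
    (h : 0 < lamMin (secondMoment ν)) (k l : Fin d) : Integrable (fun x => x k * x l) ν := by
  have hsq : ∀ k : Fin d, Integrable (fun x => x k * x k) ν := by
    intro k
    have h1 := lamMin_mul_le h (Pi.single k 1)
    simp only [mulVec_single_one, dotProduct_single_one, Pi.single_eq_same, mul_one,
      single_one_dotProduct, col_apply] at h1
    by_contra hcon
    have h2 : secondMoment ν k k = 0 := integral_undef hcon
    linarith
  refine ((hsq k).add (hsq l)).mono' (by fun_prop) (Filter.Eventually.of_forall fun x => ?_)
  rw [Real.norm_eq_abs, Pi.add_apply, abs_le]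
  constructor <;> nlinarith [sq_nonneg (x k + x l), sq_nonneg (x k - x l)]

/-- The event that the empirical second moments are entrywise `η`-close to those of `ν`. -/
def momentClose {d : ℕ} (ν : Measure (Fin d → ℝ)) (n : ℕ) (η : ℝ) : Set (Fin n → Fin d → ℝ) :=
  ⋂ k, ⋂ l, {X | |(∑ i, X i k * X i l) / n - secondMoment ν k l| < η}

theorem measurableSet_momentClose {d : ℕ} (ν : Measure (Fin d → ℝ)) (n : ℕ) (η : ℝ) :
    MeasurableSet (momentClose ν n η) :=
  .iInter fun _ => .iInter fun _ => measurableSet_lt (by fun_prop) measurable_const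

theorem tendsto_measureReal_compl_momentClose {d : ℕ} (ν : Measure (Fin d → ℝ))
    [IsProbabilityMeasure ν] (h : 0 < lamMin (secondMoment ν)) {η : ℝ} (hη : 0 < η) :
    Filter.Tendsto (fun n => (Measure.pi fun _ : Fin n => ν).real (momentClose ν n η)ᶜ)
      Filter.atTop (nhds 0) := by
  have hlim : Filter.Tendsto (fun n : ℕ => ∑ k, ∑ l, (Measure.pi fun _ : Fin n => ν).real
      {X | η ≤ |(∑ i, X i k * X i l) / n - ∫ x, x k * x l ∂ν|}) Filter.atTop
      (nhds (∑ _k : Fin d, ∑ _l : Fin d, 0)) :=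
    tendsto_finsetSum _ fun k _ => tendsto_finsetSum _ fun l _ =>
      tendsto_measureReal_abs_average_sub_ge ν (f := fun x => x k * x l) (by fun_prop)
        (integrable_mul_of_lamMin_pos h k l) hη
  simp only [Finset.sum_const_zero] at hlim
  refine squeeze_zero (fun _ => measureReal_nonneg) (fun n => ?_) hlim
  rw [momentClose, Set.compl_iInter]
  refine (measureReal_iUnion_fintype_le _).trans (Finset.sum_le_sum fun k _ => ?_)
  rw [Set.compl_iInter]
  refine (measureReal_iUnion_fintype_le _).trans (Finset.sum_le_sum fun l _ => le_of_eq ?_)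
  congr 1
  ext X
  simp [secondMoment]

theorem exists_tendsto_atTop_eventually {p : ℕ → ℕ → Prop}
    (h : ∀ k, ∀ᶠ n in Filter.atTop, p k n) :
    ∃ φ : ℕ → ℕ, Filter.Tendsto φ Filter.atTop Filter.atTop ∧
      ∀ᶠ n in Filter.atTop, p (φ n) n := by
  classical
  refine ⟨fun n => Nat.findGreatest (fun k => ∀ m, n ≤ m → p k m) n, ?_, ?_⟩
  · refine Filter.tendsto_atTop.2 fun k => ?_
    obtain ⟨N, hN⟩ := Filter.eventually_atTop.1 (h k)
    filter_upwards [Filter.eventually_ge_atTop (max N k)] with n hn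
    exact Nat.le_findGreatest ((le_max_right _ _).trans hn)
      fun m hm => hN m (((le_max_left _ _).trans hn).trans hm)
  · obtain ⟨N, hN⟩ := Filter.eventually_atTop.1 (h 0)
    filter_upwards [Filter.eventually_ge_atTop N] with n hn
    exact Nat.findGreatest_spec (P := fun k => ∀ m, n ≤ m → p k m) (Nat.zero_le n)
      (fun m hm => hN m (hn.trans hm)) n le_rfl

/-- The residual quadratic form of `AX`, after projecting out the columns of `X`, is bounded
below by `L`. -/
def residualGe (n d : ℕ) (L : ℝ) : Set ((Fin n → Fin n → ℝ) × (Fin n → Fin d → ℝ)) :=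
  {p | ∀ v : Fin d → ℝ, L * ∑ k, (v k)^2
    ≤ v ⬝ᵥ ((1/(n:ℝ)) •
        ((Matrix.of p.2).transpose * (skA n p.1).transpose
          * ((1 : Matrix (Fin n) (Fin n) ℝ)
              - Matrix.of p.2
                * ((Matrix.of p.2).transpose * Matrix.of p.2)⁻¹
                * (Matrix.of p.2).transpose)
          * skA n p.1 * Matrix.of p.2)).mulVec v}

theorem mem_residualGe_of_momentClose {n d : ℕ} {ν : Measure (Fin d → ℝ)} (hn : 0 < n)
    (h : 0 < lamMin (secondMoment ν)) {η : ℝ} (hη : 0 < η)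
    (hηL : d * η ≤ lamMin (secondMoment ν) / 2)
    (hnη : ∀ k l, |secondMoment ν k l| ≤ η * n)
    {p : (Fin n → Fin n → ℝ) × (Fin n → Fin d → ℝ)} (hX : p.2 ∈ momentClose ν n η)
    (hp : p ∉ skFluct n d η) :
    p ∈ residualGe n d (lamMin (secondMoment ν) - 4 * (d * η)) := by
  have hn' : (0 : ℝ) < n := by exact_mod_cast hn
  have hn1 : (1 : ℝ) ≤ n := by exact_mod_cast hn
  simp only [momentClose, Set.mem_iInter, Set.mem_ofPred_eq] at hX
  simp only [skFluct, Set.mem_iUnion, Set.mem_union, Set.mem_ofPred_eq, not_exists, not_or,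
    not_le] at hp
  intro v
  have hsum : ∑ k, (v k) ^ 2 = v ⬝ᵥ v := by simp only [dotProduct, sq]
  have key := quadratic_form_residual_ge hn (Matrix.of p.2) (skA n p.1 * Matrix.of p.2)
    (secondMoment ν) h (lamMin_mul_le h) hη.le hηL ?_ ?_ ?_ v
  · rw [hsum]
    simpa only [Matrix.transpose_mul, Matrix.mul_assoc] using key
  · intro k l
    have e : ((1 / (n : ℝ)) • ((Matrix.of p.2)ᵀ * Matrix.of p.2) - secondMoment ν) k l
        = (∑ i, p.2 i k * p.2 i l) / n - secondMoment ν k l := by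
      simp [Matrix.mul_apply, div_eq_inv_mul]
    rw [e]
    exact (hX k l).le
  · intro k l
    have e : ((1 / (n : ℝ)) • ((skA n p.1 * Matrix.of p.2)ᵀ * (skA n p.1 * Matrix.of p.2))
        - secondMoment ν) k l = skCross p.1 (fun i => p.2 i k) (fun i => p.2 i l) / n
          + ((n - 1) / n * ((∑ i, p.2 i k * p.2 i l) / n - secondMoment ν k l)
            - secondMoment ν k l / n) := by
      have e2 : ((skA n p.1 * Matrix.of p.2)ᵀ * (skA n p.1 * Matrix.of p.2)) k l
          = (skA n p.1).mulVec (fun i => p.2 i k) ⬝ᵥ (skA n p.1).mulVec fun i => p.2 i l := rfl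
      rw [Matrix.sub_apply, Matrix.smul_apply, e2, skCross]
      simp only [dotProduct, smul_eq_mul]
      field_simp
      ring
    have h1 : |skCross p.1 (fun i => p.2 i k) (fun i => p.2 i l) / n| ≤ η := by
      rw [abs_div, abs_of_pos hn', div_le_iff₀ hn']; exact (hp k l).1.le
    have h2 : |((n : ℝ) - 1) / n * ((∑ i, p.2 i k * p.2 i l) / n - secondMoment ν k l)| ≤ η := by
      rw [abs_mul, abs_of_nonneg (div_nonneg (by linarith) hn'.le)]
      exact (mul_le_of_le_one_left (abs_nonneg _) ((div_le_one hn').2 (by linarith))).trans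
        (hX k l).le
    have h3 : |secondMoment ν k l / n| ≤ η := by
      rw [abs_div, abs_of_pos hn', div_le_iff₀ hn']; exact hnη k l
    rw [e]
    refine (abs_add_le _ _).trans ?_
    linarith [abs_sub (((n : ℝ) - 1) / n * ((∑ i, p.2 i k * p.2 i l) / n - secondMoment ν k l))
      (secondMoment ν k l / n)]
  · intro k l
    have e : ((1 / (n : ℝ)) • ((Matrix.of p.2)ᵀ * (skA n p.1 * Matrix.of p.2))) k l
        = ((fun i => p.2 i k) ⬝ᵥ (skA n p.1).mulVec fun i => p.2 i l) / n := by
      rw [Matrix.smul_apply, smul_eq_mul, one_div, div_eq_inv_mul]; rfl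
    rw [e, abs_div, abs_of_pos hn', div_le_iff₀ hn']
    exact (hp k l).2.le

theorem eventually_measureReal_compl_residualGe_le {d : ℕ} (ν : Measure (Fin d → ℝ))
    [IsProbabilityMeasure ν] (h : 0 < lamMin (secondMoment ν)) {ε δ : ℝ} (hε : 0 < ε)
    (hδ : 0 < δ) :
    ∀ᶠ n in Filter.atTop, ((gaussArray n).prod (Measure.pi fun _ : Fin n => ν)).real
      (residualGe n d (lamMin (secondMoment ν) - ε))ᶜ ≤ δ := by
  obtain ⟨η, hη, hηL, hηε⟩ : ∃ η : ℝ, 0 < η ∧ d * η ≤ lamMin (secondMoment ν) / 2 ∧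
      4 * (d * η) ≤ ε := by
    have hd : (0 : ℝ) < d + 1 := by positivity
    have hm : 0 < min (lamMin (secondMoment ν) / 2) (ε / 4) := lt_min (by linarith) (by linarith)
    have hle : d * (min (lamMin (secondMoment ν) / 2) (ε / 4) / (d + 1))
        ≤ min (lamMin (secondMoment ν) / 2) (ε / 4) := by
      rw [mul_div_assoc', div_le_iff₀ hd]; nlinarith
    refine ⟨_, div_pos hm hd, hle.trans (min_le_left _ _), ?_⟩
    linarith [hle.trans (min_le_right _ _)]
  set K := ∑ k, |secondMoment ν k k| + η with hK
  have hlim : Filter.Tendsto (fun n : ℕ => d * (d * (18 * K ^ 2 / η ^ 2 / n))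
      + (Measure.pi fun _ : Fin n => ν).real (momentClose ν n η)ᶜ) Filter.atTop
      (nhds ((d : ℝ) * (d * 0) + 0)) :=
    (((tendsto_const_div_atTop_nhds_zero_nat _).const_mul _).const_mul _).add
      (tendsto_measureReal_compl_momentClose ν h hη)
  simp only [mul_zero, add_zero] at hlim
  have hlarge : ∀ᶠ n : ℕ in Filter.atTop, ∀ k l, |secondMoment ν k l| ≤ η * n :=
    Filter.eventually_all.2 fun k => Filter.eventually_all.2 fun l =>
      (tendsto_natCast_atTop_atTop.const_mul_atTop hη).eventually_ge_atTop _
  filter_upwards [hlim.eventually (gt_mem_nhds hδ), hlarge, Filter.eventually_gt_atTop 0]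
    with n hn1 hn2 hn0
  have hn' : (0 : ℝ) < n := by exact_mod_cast hn0
  have hbad := measureReal_prod_le_of_section_le (μ := gaussArray n)
    (ν := Measure.pi fun _ : Fin n => ν) (measurableSet_skFluct n d η)
    (measurableSet_momentClose ν n η) (ε := d * (d * (18 * K ^ 2 / η ^ 2 / n))) (by positivity)
    fun X hX => measureReal_skFluct_section_le hn0 hη X fun k => by
      simp only [momentClose, Set.mem_iInter, Set.mem_ofPred_eq] at hX
      have h1 := (abs_lt.1 (hX k k)).2
      have h2 : secondMoment ν k k ≤ ∑ k, |secondMoment ν k k| :=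
        (le_abs_self _).trans (Finset.single_le_sum (f := fun k => |secondMoment ν k k|)
          (fun _ _ => abs_nonneg _) (Finset.mem_univ k))
      rw [← div_le_iff₀ hn']
      simp only [dotProduct]
      linarith
  refine (measureReal_mono (fun p hp => ?_) (measure_ne_top _ _)).trans (hbad.trans hn1.le)
  by_contra hcon
  simp only [Set.mem_union, Set.mem_preimage, Set.mem_compl_iff, not_or, not_not] at hcon
  refine hp fun v => le_trans ?_
    (mem_residualGe_of_momentClose hn0 h hη hηL hn2 hcon.2 hcon.1 v)
  have : 0 ≤ ∑ k, (v k) ^ 2 := Finset.sum_nonneg fun _ _ => sq_nonneg _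
  gcongr

theorem exists_tendsto_zero_residualGe {d : ℕ} (ν : Measure (Fin d → ℝ))
    [IsProbabilityMeasure ν] (h : 0 < lamMin (secondMoment ν)) :
    ∃ εs : ℕ → ℝ, Filter.Tendsto εs Filter.atTop (nhds 0) ∧ ∀ δ : ℝ, 0 < δ →
      ∀ᶠ n in Filter.atTop, ((gaussArray n).prod (Measure.pi fun _ : Fin n => ν)).real
        (residualGe n d (lamMin (secondMoment ν) - εs n))ᶜ ≤ δ := by
  obtain ⟨φ, hφ, hev⟩ := exists_tendsto_atTop_eventually fun k : ℕ =>
    eventually_measureReal_compl_residualGe_le ν h (Nat.one_div_pos_of_nat (α := ℝ) (n := k))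
      (Nat.one_div_pos_of_nat (α := ℝ) (n := k))
  have hlim := (tendsto_one_div_add_atTop_nhds_zero_nat (𝕜 := ℝ)).comp hφ
  refine ⟨_, hlim, fun δ hδ => ?_⟩
  filter_upwards [hev, hlim.eventually (gt_mem_nhds hδ)] with n hn1 hn2
  exact hn1.trans hn2.le

end SKEstimates

/-- **The Sherrington–Kirkpatrick interaction matrix satisfies the
assumptions for consistent estimation.** There are absolute constants `C₀, c₀ > 0`
such that with probability tending to 1: (i) `‖A‖₂ ≤ C₀`; (ii) `‖A‖_F² ≥ c₀ n`.
Moreover, for `X` an `n×d` matrix independent of `A` with i.i.d. subgaussian rows of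
second moment matrix `Q`, `λ_min(Q) > 0`, satisfying `(1/√n)‖X‖₂ < 1/(2‖A‖₂²)` (and
`X` of rank `d`), with probability tending to 1 (for fixed `d`),
`λ_min((1/n) Xᵀ Aᵀ F A X) ≥ λ_min(Q) − o(1) > 0`, where `F = I − X(XᵀX)⁻¹Xᵀ`. -/
theorem statement19 :
    (∃ C₀ c₀ : ℝ, 0 < C₀ ∧ 0 < c₀ ∧
      ∀ ε : ℝ, 0 < ε → ∃ N : ℕ, ∀ n : ℕ, N ≤ n →
        gaussArray n {ω | specNorm (skA n ω) ≤ C₀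
            ∧ c₀ * n ≤ ∑ i, ∑ j, (skA n ω i j)^2}
          ≥ ENNReal.ofReal (1 - ε))
    ∧ ∀ (d : ℕ) (ν : Measure (Fin d → ℝ)), IsProbabilityMeasure ν →
        -- ν is subgaussian
        (∃ K : ℝ, ∀ u : Fin d → ℝ,
          (∫ x, Real.exp (∑ k, u k * x k) ∂ν) ≤ Real.exp (K * ∑ k, (u k)^2)) →
        0 < lamMin (secondMoment ν) →
        ∃ εs : ℕ → ℝ, Filter.Tendsto εs Filter.atTop (nhds 0) ∧
          ∀ δ : ℝ, 0 < δ → ∃ N : ℕ, ∀ n : ℕ, N ≤ n →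
            ((gaussArray n).prod (Measure.pi fun _ : Fin n => ν))
              {p : (Fin n → Fin n → ℝ) × (Fin n → Fin d → ℝ) |
                (Matrix.of p.2).rank = d →
                (1 / Real.sqrt n) * opNorm (Matrix.of p.2)
                    < 1 / (2 * (specNorm (skA n p.1))^2) →
                  (∀ v : Fin d → ℝ,
                    (lamMin (secondMoment ν) - εs n) * ∑ k, (v k)^2
                      ≤ v ⬝ᵥ ((1/(n:ℝ)) •
                          ((Matrix.of p.2).transpose * (skA n p.1).transpose
                            * ((1 : Matrix (Fin n) (Fin n) ℝ)
                                - Matrix.of p.2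
                                  * ((Matrix.of p.2).transpose * Matrix.of p.2)⁻¹
                                  * (Matrix.of p.2).transpose)
                            * skA n p.1 * Matrix.of p.2)).mulVec v)
                  ∧ 0 < lamMin (secondMoment ν) - εs n}
              ≥ ENNReal.ofReal (1 - δ) := by
  refine ⟨⟨32, 1 / 2, by norm_num, by norm_num, fun ε hε =>
    exists_forall_ofReal_one_sub_le_gaussArray hε⟩, fun d ν hν _ hpos => ?_⟩
  obtain ⟨εs, hlim, hev⟩ := exists_tendsto_zero_residualGe ν hpos
  refine ⟨εs, hlim, fun δ hδ => ?_⟩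
  obtain ⟨N, hN⟩ := Filter.eventually_atTop.1 ((hev δ hδ).and (hlim.eventually (gt_mem_nhds hpos)))
  refine ⟨N, fun n hn => (ofReal_one_sub_le_measure (hN n hn).1).trans
    (measure_mono fun p hp _ _ => ⟨hp, sub_pos.2 (hN n hn).2⟩)⟩
end
end
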